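/- arXiv:1801.00486 — 12 statements merged into one kernel-verified Lean document; each statement's English description precedes it below -/
import Mathlib

section
/- For every z ∈ ℂ with 0 < |z| ≤ q^{−1/2}, one has |g_odd(z)/z³ − 1/z² − 14 − q z²| ≤ ((15 q^{−7} + 119 q^{−6} + 412 q^{−5} + 812 q^{−4} + 994 q^{−3} + 770 q^{−2} + 363 q^{−1} + 99)/(1 − q^{−1})⁸) · |z|². (This is the asymptotic F(q^{−1/2}, q^{−1/2}, q^{−1/2}, z; q) = 14 + q z² + O(z²), with an explicit constant, for the function F(z₁,z₂,z₃,z₄;q) = z₄^{−3} f_odd(z₁,z₂,z₃,z₄;q) − z₄^{−2}.) -/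
/-- `f_odd(q^{−1/2}, q^{−1/2}, q^{−1/2}, z; q) = z(1 + 7z² + 7z⁴ + z⁶)/((1 − z²)⁷(1 − q z⁴))`. -/
noncomputable def gOdd (q : ℝ) (z : ℂ) : ℂ :=
  z * (1 + 7 * z ^ 2 + 7 * z ^ 4 + z ^ 6) / ((1 - z ^ 2) ^ 7 * (1 - (q : ℂ) * z ^ 4))

/-- The numerator `N_ε(z)`. -/
noncomputable def Neps (q ε : ℝ) (z : ℂ) : ℂ :=
  1 + ((7 - 14 * ε * q ^ (-(1 : ℝ) / 2) + 6 * q⁻¹ - ε * q ^ (-(3 : ℝ) / 2) : ℝ) : ℂ) * z ^ 2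
    + 7 * ((1 - 4 * ε * q ^ (-(1 : ℝ) / 2) + 4 * q⁻¹ - ε * q ^ (-(3 : ℝ) / 2) : ℝ) : ℂ) * z ^ 4
    + ((1 - 6 * ε * q ^ (-(1 : ℝ) / 2) + 14 * q⁻¹ - 7 * ε * q ^ (-(3 : ℝ) / 2) : ℝ) : ℂ) * z ^ 6
    - ((ε * q ^ (-(3 : ℝ) / 2) : ℝ) : ℂ) * z ^ 8

/-- `g_ε(z) = N_ε(z)/((1 − z²)⁷(1 − q z⁴))`. -/
noncomputable def gEps (q ε : ℝ) (z : ℂ) : ℂ :=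
  Neps q ε z / ((1 - z ^ 2) ^ 7 * (1 - (q : ℂ) * z ^ 4))

/-- `Φ_ε(z) = (1 − ε q^{−1/2})^{−3} g_ε(z) = f_even(ε q^{−1/2}, ε q^{−1/2}, ε q^{−1/2}, z; q)`. -/
noncomputable def PhiEps (q ε : ℝ) (z : ℂ) : ℂ :=
  (((1 - ε * q ^ (-(1 : ℝ) / 2) : ℝ) : ℂ))⁻¹ ^ 3 * gEps q ε z

/-- With `w = z²`, `gOdd q z / z³ - 1/z² - 14 - q z²` is `w` times the quotient of this polynomial
by `(1 - w)⁷ (1 - q w²)`. -/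
noncomputable def remainderNumerator (q : ℝ) (w : ℂ) : ℂ :=
  84 - 258 * w + 455 * w ^ 2 - 469 * w ^ 3 + 287 * w ^ 4 - 97 * w ^ 5 + 14 * w ^ 6
    + (14 * (q * w) + (q * w) ^ 2) * (1 - w) ^ 7

theorem gOdd_div_cube_sub_principal_part {q : ℝ} {z : ℂ} (hz : z ≠ 0) (h1 : 1 - z ^ 2 ≠ 0)
    (h2 : 1 - (q : ℂ) * z ^ 4 ≠ 0) :
    gOdd q z / z ^ 3 - 1 / z ^ 2 - 14 - (q : ℂ) * z ^ 2 =
      remainderNumerator q (z ^ 2) / ((1 - z ^ 2) ^ 7 * (1 - (q : ℂ) * z ^ 4)) * z ^ 2 := by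
  have h2' : 1 - z ^ 4 * (q : ℂ) ≠ 0 := by rwa [mul_comm]
  unfold gOdd remainderNumerator
  field_simp
  ring

theorem norm_remainderNumerator_le {q p : ℝ} {w : ℂ} (hw : ‖w‖ ≤ p) (hqw : ‖(q : ℂ) * w‖ ≤ 1) :
    ‖remainderNumerator q w‖ ≤
      15 * p ^ 7 + 119 * p ^ 6 + 412 * p ^ 5 + 812 * p ^ 4 + 994 * p ^ 3
        + 770 * p ^ 2 + 363 * p + 99 := by
  have hp : 0 ≤ p := (norm_nonneg w).trans hw
  have term (c : ℂ) (k : ℕ) : ‖c * w ^ k‖ ≤ ‖c‖ * p ^ k := by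
    rw [norm_mul, norm_pow]
    gcongr
  have hlin : ‖14 * ((q : ℂ) * w) + (q * w) ^ 2‖ ≤ 15 := by
    refine (norm_add_le _ _).trans ?_
    rw [norm_mul, norm_pow, Complex.norm_ofNat]
    nlinarith [norm_nonneg ((q : ℂ) * w)]
  have hone : ‖1 - w‖ ≤ 1 + p := norm_sub_le_of_le norm_one.le hw
  have hprod : ‖(14 * ((q : ℂ) * w) + (q * w) ^ 2) * (1 - w) ^ 7‖ ≤ 15 * (1 + p) ^ 7 := by
    rw [norm_mul, norm_pow]
    gcongr
  have key := norm_add_le_of_le (norm_add_le_of_le (norm_sub_le_of_le (norm_add_le_of_le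
    (norm_sub_le_of_le (norm_add_le_of_le (norm_sub_le_of_le (term 84 0) (term 258 1))
    (term 455 2)) (term 469 3)) (term 287 4)) (term 97 5)) (term 14 6)) hprod
  simp only [pow_zero, pow_one, mul_one, Complex.norm_ofNat] at key
  exact key.trans_eq (by ring)

/-- For every `z ∈ ℂ` with `0 < |z| ≤ q^{−1/2}`,
`|g_odd(z)/z³ − 1/z² − 14 − q z²| ≤
  ((15 q^{−7} + 119 q^{−6} + 412 q^{−5} + 812 q^{−4} + 994 q^{−3} + 770 q^{−2} + 363 q^{−1} + 99)
      /(1 − q^{−1})⁸) · |z|²`. -/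
theorem stmt_3 (q : ℝ) (hq : 5 ≤ q) (z : ℂ) (hz0 : 0 < ‖z‖) (hz : ‖z‖ ≤ q ^ (-(1 : ℝ) / 2)) :
    ‖gOdd q z / z ^ 3 - 1 / z ^ 2 - 14 - (q : ℂ) * z ^ 2‖ ≤
      ((15 * q⁻¹ ^ 7 + 119 * q⁻¹ ^ 6 + 412 * q⁻¹ ^ 5 + 812 * q⁻¹ ^ 4 + 994 * q⁻¹ ^ 3
          + 770 * q⁻¹ ^ 2 + 363 * q⁻¹ + 99) / (1 - q⁻¹) ^ 8) * ‖z‖ ^ 2 := by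
  have hq0 : 0 < q := by linarith
  have hw : ‖z ^ 2‖ ≤ q⁻¹ := by
    calc ‖z ^ 2‖ = ‖z‖ ^ 2 := norm_pow z 2
      _ ≤ (q ^ (-(1 : ℝ) / 2)) ^ 2 := by gcongr
      _ = q⁻¹ := by
        rw [← Real.rpow_natCast, ← Real.rpow_mul hq0.le, ← Real.rpow_neg_one]
        norm_num
  have hp1 : q⁻¹ < 1 := inv_lt_one_of_one_lt₀ (by linarith)
  have hqw : ‖(q : ℂ) * z ^ 2‖ ≤ 1 := by
    rw [norm_mul, Complex.norm_of_nonneg hq0.le]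
    calc q * ‖z ^ 2‖ ≤ q * q⁻¹ := by gcongr
      _ = 1 := mul_inv_cancel₀ hq0.ne'
  have hqw2 : ‖(q : ℂ) * z ^ 4‖ ≤ q⁻¹ := by
    rw [show (q : ℂ) * z ^ 4 = q * z ^ 2 * z ^ 2 by ring, norm_mul]
    exact (mul_le_of_le_one_left (norm_nonneg _) hqw).trans hw
  have one_sub_le {u : ℂ} (hu : ‖u‖ ≤ q⁻¹) : 1 - q⁻¹ ≤ ‖1 - u‖ := by
    have := norm_sub_norm_le 1 u
    rw [norm_one] at this
    linarith
  have hpos : 0 < 1 - q⁻¹ := sub_pos.2 hp1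
  have h1 := one_sub_le hw
  have h2 := one_sub_le hqw2
  rw [gOdd_div_cube_sub_principal_part (norm_pos_iff.1 hz0) (norm_pos_iff.1 (hpos.trans_le h1))
    (norm_pos_iff.1 (hpos.trans_le h2)), norm_mul, norm_div, norm_mul, norm_pow (1 - z ^ 2),
    norm_pow z, pow_succ (1 - q⁻¹) 7]
  gcongr
  exact norm_remainderNumerator_le hw hqw
end

section
/- For every z ∈ ℂ with 0 < |z| ≤ q^{−1/2}, one has |(1/(2z²))·[(1 − q^{−1/2})^{−3}(g₁(z) − 1) + (1 + q^{−1/2})^{−3}(g₋₁(z) − 1)] − 14 − q z²| ≤ (1 + q^{−1})³ (15 q^{−7} + 120 q^{−6} + 420 q^{−5} + 843 q^{−4} + 1064 q^{−3} + 866 q^{−2} + 427 q^{−1} + 153)/(q (1 − q^{−1})^{11}), where g₁ = g_{ε=1} and g₋₁ = g_{ε=−1}. (This is the asymptotic G^{(0)}(q^{−1/2}, q^{−1/2}, q^{−1/2}, z; q) = 14 + q z² + O(q^{−1}) with an explicit constant.) -/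
/-- The value at `t` of the polynomial with integer coefficients `l`, lowest degree first. -/
noncomputable def evalCoeffs (t : ℂ) (l : List ℤ) : ℂ :=
  l.foldr (fun (a : ℤ) (x : ℂ) => (a : ℂ) + t * x) 0

/-- The value at `(u, t)` of the bivariate polynomial whose coefficient of `u ^ i` is given by the
`i`-th list of coefficients in `t`. -/
noncomputable def evalCoeffs₂ (u t : ℂ) (L : List (List ℤ)) : ℂ :=
  L.foldr (fun (l : List ℤ) (x : ℂ) => evalCoeffs t l + u * x) 0

theorem norm_evalCoeffs_le {t : ℂ} (ht : ‖t‖ ≤ 1) (l : List ℤ) :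
    ‖evalCoeffs t l‖ ≤ ((l.map abs).sum : ℤ) := by
  induction l with
  | nil => simp [evalCoeffs]
  | cons a l ih =>
    have hx : ‖t * evalCoeffs t l‖ ≤ ‖evalCoeffs t l‖ := by
      rw [norm_mul]
      exact mul_le_of_le_one_left (norm_nonneg _) ht
    have ha : ‖(a : ℂ)‖ = ((|a| : ℤ) : ℝ) := by
      rw [Complex.norm_intCast, Int.cast_abs]
    calc ‖evalCoeffs t (a :: l)‖ = ‖(a : ℂ) + t * evalCoeffs t l‖ := rfl
      _ ≤ ‖(a : ℂ)‖ + ‖t * evalCoeffs t l‖ := norm_add_le _ _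
      _ ≤ (((a :: l).map abs).sum : ℤ) := by
        rw [List.map_cons, List.sum_cons, Int.cast_add, ha]
        linarith

theorem norm_evalCoeffs₂_le {t : ℂ} (ht : ‖t‖ ≤ 1) {u : ℝ} (hu : 0 ≤ u) (L : List (List ℤ)) :
    ‖evalCoeffs₂ u t L‖ ≤ L.foldr (fun l x => (((l.map abs).sum : ℤ) : ℝ) + u * x) 0 := by
  induction L with
  | nil => simp [evalCoeffs₂]
  | cons l L ih =>
    calc ‖evalCoeffs₂ u t (l :: L)‖ = ‖evalCoeffs t l + u * evalCoeffs₂ u t L‖ := rfl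
      _ ≤ ‖evalCoeffs t l‖ + ‖(u : ℂ) * evalCoeffs₂ u t L‖ := norm_add_le _ _
      _ ≤ _ := by
        rw [norm_mul, Complex.norm_of_nonneg hu, List.foldr_cons]
        exact add_le_add (norm_evalCoeffs_le ht l) (mul_le_mul_of_nonneg_left ih hu)

/-- Coefficients of the numerator of the remainder in the expansion of the even part, as a
polynomial in `u = q⁻¹` and `t = q z²`. -/
def remainderCoeffs : List (List ℤ) :=
  [[48, 90, 14, 1],
   [-41, -395, -342, -101, -7],
   [13, 330, 1049, 878, 315, 21],
   [0, -105, -888, -1933, -1582, -553, -35],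
   [0, 0, 287, 1586, 2527, 2030, 595, 35],
   [0, 0, 0, -491, -1799, -2499, -1798, -399, -21],
   [0, 0, 0, 0, 490, 1407, 1865, 1043, 161, 7],
   [0, 0, 0, 0, 0, -294, -805, -980, -363, -35, -1],
   [0, 0, 0, 0, 0, 0, 98, 343, 318, 63, 3],
   [0, 0, 0, 0, 0, 0, 0, -14, -99, -49, -3],
   [0, 0, 0, 0, 0, 0, 0, 0, 0, 14, 1]]

theorem norm_remainder_le {t : ℂ} (ht : ‖t‖ ≤ 1) {u : ℝ} (hu : 0 ≤ u) :
    ‖evalCoeffs₂ u t remainderCoeffs‖ ≤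
      (1 + u) ^ 3 * (15 * u ^ 7 + 120 * u ^ 6 + 420 * u ^ 5 + 843 * u ^ 4 + 1064 * u ^ 3
        + 866 * u ^ 2 + 427 * u + 153) := by
  refine (norm_evalCoeffs₂_le ht hu remainderCoeffs).trans_eq ?_
  simp only [remainderCoeffs, List.foldr_cons, List.foldr_nil, List.map_cons, List.map_nil,
    List.sum_cons, List.sum_nil]
  norm_num
  ring

/-- The numerator `N_ε` in terms of `s = q ^ (-1/2)` and `w = z²`. -/
theorem Neps_eq {q s : ℝ} (hs : q ^ (-(1 : ℝ) / 2) = s) (hs₂ : q⁻¹ = s ^ 2)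
    (hs₃ : q ^ (-(3 : ℝ) / 2) = s ^ 3) (ε : ℝ) (z : ℂ) :
    Neps q ε z = 1 + (7 - 14 * ε * s + 6 * s ^ 2 - ε * s ^ 3) * z ^ 2
      + 7 * (1 - 4 * ε * s + 4 * s ^ 2 - ε * s ^ 3) * (z ^ 2) ^ 2
      + (1 - 6 * ε * s + 14 * s ^ 2 - 7 * ε * s ^ 3) * (z ^ 2) ^ 3
      - ε * s ^ 3 * (z ^ 2) ^ 4 := by
  rw [Neps, hs, hs₂, hs₃]
  push_cast
  ring

/-- The polynomial identity expressing the combined numerators through the remainder. -/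
theorem numerator_identity (s t : ℂ) :
    let w := s ^ 2 * t
    let D := (1 - w) ^ 7 * (1 - s ^ 2 * t ^ 2)
    (1 + s) ^ 3 * ((1 + (7 - 14 * s + 6 * s ^ 2 - s ^ 3) * w
        + 7 * (1 - 4 * s + 4 * s ^ 2 - s ^ 3) * w ^ 2
        + (1 - 6 * s + 14 * s ^ 2 - 7 * s ^ 3) * w ^ 3 - s ^ 3 * w ^ 4) - D)
      + (1 - s) ^ 3 * ((1 + (7 + 14 * s + 6 * s ^ 2 + s ^ 3) * w
        + 7 * (1 + 4 * s + 4 * s ^ 2 + s ^ 3) * w ^ 2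
        + (1 + 6 * s + 14 * s ^ 2 + 7 * s ^ 3) * w ^ 3 + s ^ 3 * w ^ 4) - D)
      = 2 * w * ((14 + t) * ((1 - s ^ 2) ^ 3 * D)
          + s ^ 2 * evalCoeffs₂ (s ^ 2) t remainderCoeffs) := by
  simp only [evalCoeffs₂, evalCoeffs, remainderCoeffs, List.foldr_cons, List.foldr_nil]
  push_cast
  ring

theorem inv_mul_combination {F : Type*} [Field F] {s w D t N M r : F} (h₂ : (2 : F) ≠ 0)
    (hw : w ≠ 0) (hD : D ≠ 0) (hm : 1 - s ≠ 0) (hp : 1 + s ≠ 0)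
    (h : (1 + s) ^ 3 * (N - D) + (1 - s) ^ 3 * (M - D)
      = 2 * w * ((14 + t) * ((1 - s ^ 2) ^ 3 * D) + r)) :
    1 / (2 * w) * ((1 - s)⁻¹ ^ 3 * (N / D - 1) + (1 + s)⁻¹ ^ 3 * (M / D - 1)) - 14 - t
      = r / ((1 - s ^ 2) ^ 3 * D) := by
  have hs : 1 - s ^ 2 = (1 - s) * (1 + s) := by ring
  have hs' : 1 - s ^ 2 ≠ 0 := hs ▸ mul_ne_zero hm hp
  have key : (1 - s)⁻¹ ^ 3 * (N / D - 1) + (1 + s)⁻¹ ^ 3 * (M / D - 1)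
      = ((1 + s) ^ 3 * (N - D) + (1 - s) ^ 3 * (M - D)) / ((1 - s ^ 2) ^ 3 * D) := by
    rw [hs]
    field_simp
  rw [key, h]
  field_simp
  ring

/-- A lower bound for the denominator on `‖t‖ ≤ 1`. -/
theorem pow_le_norm_denominator {u : ℝ} (hu : 0 ≤ u) (hu₁ : u ≤ 1) {t : ℂ} (ht : ‖t‖ ≤ 1) :
    (1 - u) ^ 8 ≤ ‖(1 - (u : ℂ) * t) ^ 7 * (1 - (u : ℂ) * t ^ 2)‖ := by
  have hx : ∀ x : ℂ, ‖x‖ ≤ 1 → 1 - u ≤ ‖1 - (u : ℂ) * x‖ := by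
    intro x hx
    have h := norm_sub_norm_le (1 : ℂ) ((u : ℂ) * x)
    rw [norm_one, norm_mul, Complex.norm_of_nonneg hu] at h
    have := mul_le_of_le_one_right hu hx
    linarith
  have ht₂ : ‖t ^ 2‖ ≤ 1 := by
    rw [norm_pow]
    exact pow_le_one₀ (norm_nonneg _) ht
  rw [norm_mul, norm_pow, pow_succ (1 - u) 7]
  have h₀ : 0 ≤ 1 - u := by linarith
  exact mul_le_mul (pow_le_pow_left₀ h₀ (hx t ht) 7) (hx _ ht₂) h₀ (by positivity)

/-- For every `z ∈ ℂ` with `0 < |z| ≤ q^{−1/2}`,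
`|(1/(2z²))·[(1 − q^{−1/2})^{−3}(g₁(z) − 1) + (1 + q^{−1/2})^{−3}(g₋₁(z) − 1)] − 14 − q z²|
  ≤ (1 + q^{−1})³ (15 q^{−7} + 120 q^{−6} + 420 q^{−5} + 843 q^{−4} + 1064 q^{−3} + 866 q^{−2}
      + 427 q^{−1} + 153)/(q (1 − q^{−1})^{11})`. -/
theorem stmt_4 (q : ℝ) (hq : 5 ≤ q) (z : ℂ) (hz0 : 0 < ‖z‖) (hz : ‖z‖ ≤ q ^ (-(1 : ℝ) / 2)) :
    ‖(1 / (2 * z ^ 2)) *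
        ((((1 - q ^ (-(1 : ℝ) / 2) : ℝ) : ℂ))⁻¹ ^ 3 * (gEps q 1 z - 1)
          + (((1 + q ^ (-(1 : ℝ) / 2) : ℝ) : ℂ))⁻¹ ^ 3 * (gEps q (-1) z - 1))
      - 14 - (q : ℂ) * z ^ 2‖ ≤
      (1 + q⁻¹) ^ 3 * (15 * q⁻¹ ^ 7 + 120 * q⁻¹ ^ 6 + 420 * q⁻¹ ^ 5 + 843 * q⁻¹ ^ 4
          + 1064 * q⁻¹ ^ 3 + 866 * q⁻¹ ^ 2 + 427 * q⁻¹ + 153) / (q * (1 - q⁻¹) ^ 11) := by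
  have hq₀ : 0 < q := by linarith
  obtain ⟨s, hs⟩ : ∃ s, q ^ (-(1 : ℝ) / 2) = s := ⟨_, rfl⟩
  have hs₀ : 0 < s := hs ▸ Real.rpow_pos_of_pos hq₀ _
  have hs₂ : q⁻¹ = s ^ 2 := by
    rw [← hs, ← Real.rpow_natCast, ← Real.rpow_mul hq₀.le, ← Real.rpow_neg_one]
    norm_num
  have hs₃ : q ^ (-(3 : ℝ) / 2) = s ^ 3 := by
    rw [← hs, ← Real.rpow_natCast, ← Real.rpow_mul hq₀.le]
    norm_num
  have hqs : q = (s ^ 2)⁻¹ := by rw [← hs₂, inv_inv]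
  have hu₁ : s ^ 2 < 1 := by
    rw [← hs₂]
    exact inv_lt_one_of_one_lt₀ (by linarith)
  have hs₁ : s < 1 := by nlinarith
  have hz' : z ≠ 0 := norm_pos_iff.mp hz0
  have hsC : (s : ℂ) ≠ 0 := by exact_mod_cast hs₀.ne'
  obtain ⟨t, ht⟩ : ∃ t : ℂ, (q : ℂ) * z ^ 2 = t := ⟨_, rfl⟩
  have hw : z ^ 2 = (s : ℂ) ^ 2 * t := by
    rw [← ht, hqs]
    push_cast
    field_simp
  have ht₁ : ‖t‖ ≤ 1 := by
    have h : ‖z‖ ^ 2 ≤ s ^ 2 := pow_le_pow_left₀ (norm_nonneg z) (hs ▸ hz) 2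
    rw [← norm_pow, hw, norm_mul, norm_pow, Complex.norm_of_nonneg hs₀.le] at h
    exact le_of_mul_le_mul_left (by simpa using h) (by positivity : 0 < s ^ 2)
  have hD : (1 - z ^ 2) ^ 7 * (1 - (q : ℂ) * z ^ 4)
      = (1 - (s : ℂ) ^ 2 * t) ^ 7 * (1 - (s : ℂ) ^ 2 * t ^ 2) := by
    rw [show (q : ℂ) * z ^ 4 = z ^ 2 * (q * z ^ 2) by ring, ht, hw]
    ring
  have hlow := pow_le_norm_denominator (sq_nonneg s) hu₁.le ht₁
  rw [Complex.ofReal_pow] at hlow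
  have hu₀ : 0 < 1 - s ^ 2 := by linarith
  have hD₀ : (1 - (s : ℂ) ^ 2 * t) ^ 7 * (1 - (s : ℂ) ^ 2 * t ^ 2) ≠ 0 :=
    norm_pos_iff.mp (lt_of_lt_of_le (by positivity) hlow)
  have hm : (1 : ℂ) - s ≠ 0 := by exact_mod_cast (sub_pos.mpr hs₁).ne'
  have hp : (1 : ℂ) + s ≠ 0 := by exact_mod_cast (by positivity : (0 : ℝ) < 1 + s).ne'
  have hw₀ : (s : ℂ) ^ 2 * t ≠ 0 := hw ▸ pow_ne_zero 2 hz'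
  have hrem := norm_remainder_le ht₁ (sq_nonneg s)
  rw [Complex.ofReal_pow] at hrem
  have heq := inv_mul_combination (t := t) two_ne_zero hw₀ hD₀ hm hp (numerator_identity s t)
  have hlhs : (1 / (2 * z ^ 2)) *
        ((((1 - s : ℝ) : ℂ))⁻¹ ^ 3 * (gEps q 1 z - 1)
          + (((1 + s : ℝ) : ℂ))⁻¹ ^ 3 * (gEps q (-1) z - 1)) - 14 - (q : ℂ) * z ^ 2
      = (s : ℂ) ^ 2 * evalCoeffs₂ ((s : ℂ) ^ 2) t remainderCoeffs
        / ((1 - (s : ℂ) ^ 2) ^ 3 * ((1 - (s : ℂ) ^ 2 * t) ^ 7 * (1 - (s : ℂ) ^ 2 * t ^ 2))) := by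
    rw [← heq, gEps, gEps, hD, Neps_eq hs hs₂ hs₃, Neps_eq hs hs₂ hs₃, ht, hw]
    push_cast
    congr 6 <;> ring
  have hden : ‖(1 - (s : ℂ) ^ 2) ^ 3‖ = (1 - s ^ 2) ^ 3 := by
    rw [norm_pow, ← Complex.ofReal_pow, ← Complex.ofReal_one, ← Complex.ofReal_sub,
      Complex.norm_of_nonneg hu₀.le]
  rw [hs, hlhs, norm_div, norm_mul, norm_mul, hden, norm_pow, Complex.norm_of_nonneg hs₀.le, hs₂,
    ← div_div _ q, div_eq_mul_inv _ q, hs₂, mul_comm _ (s ^ 2), pow_add (1 - s ^ 2) 3 8]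
  gcongr
end

section
/- For every z ∈ ℂ with 0 < |z| ≤ q^{−1/2}, one has |(1/(2z²))·[(1 − q^{−1/2})^{−3}(g₁(z) − 1) − (1 + q^{−1/2})^{−3}(g₋₁(z) − 1)]| ≤ (q^{−7} + 10 q^{−6} + 36 q^{−5} + 65 q^{−4} + 121 q^{−3} + 134 q^{−2} + 70 q^{−1} + 31)/((1 − q^{−1})^{10} · q^{1/2}), where g₁ = g_{ε=1} and g₋₁ = g_{ε=−1}. (This is the estimate G^{(1)}(q^{−1/2}, q^{−1/2}, q^{−1/2}, z; q) = O(q^{−1/2}) with an explicit constant.) -/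
/-- The numerator left after clearing denominators in
`((1 - s)⁻³ (g₁ - 1) - (1 + s)⁻³ (g₋₁ - 1)) / (2 z²)`, divided by `s`, where `p = s² = q⁻¹` and
`u = q z²`. -/
def reducedNumerator (p u : ℂ) : ℂ :=
  (28 - 11 * p + 3 * p ^ 2) + (3 - 69 * p - 21 * p ^ 2 + 7 * p ^ 3) * u
    + (-21 * p + 95 * p ^ 2 + 53 * p ^ 3 - 7 * p ^ 4) * u ^ 2
    + (63 * p ^ 2 - 84 * p ^ 3 - 36 * p ^ 4 - 3 * p ^ 5) * u ^ 3
    + (-105 * p ^ 3 + 28 * p ^ 4 + 21 * p ^ 5) * u ^ 4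
    + (105 * p ^ 4 + 14 * p ^ 5 - 7 * p ^ 6) * u ^ 5
    + (-63 * p ^ 5 - 18 * p ^ 6 + p ^ 7) * u ^ 6
    + (21 * p ^ 6 + 7 * p ^ 7) * u ^ 7 + (-3 * p ^ 7 - p ^ 8) * u ^ 8

theorem sum_abs_coeff_le {p : ℝ} (hp0 : 0 ≤ p) (hp : p ≤ 1 / 5) :
    |28 - 11 * p + 3 * p ^ 2| + |3 - 69 * p - 21 * p ^ 2 + 7 * p ^ 3|
      + |-21 * p + 95 * p ^ 2 + 53 * p ^ 3 - 7 * p ^ 4|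
      + |63 * p ^ 2 - 84 * p ^ 3 - 36 * p ^ 4 - 3 * p ^ 5|
      + |-105 * p ^ 3 + 28 * p ^ 4 + 21 * p ^ 5| + |105 * p ^ 4 + 14 * p ^ 5 - 7 * p ^ 6|
      + |-63 * p ^ 5 - 18 * p ^ 6 + p ^ 7| + |21 * p ^ 6 + 7 * p ^ 7| + |-3 * p ^ 7 - p ^ 8|
      ≤ (1 - p) * (p ^ 7 + 10 * p ^ 6 + 36 * p ^ 5 + 65 * p ^ 4 + 121 * p ^ 3 + 134 * p ^ 2
          + 70 * p + 31) := by
  have step : ∀ n : ℕ, 0 ≤ p ^ n ∧ p ^ (n + 1) ≤ 1 / 5 * p ^ n := fun n =>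
    ⟨by positivity, by
      rw [pow_succ']
      exact mul_le_mul_of_nonneg_right hp (by positivity)⟩
  obtain ⟨n2, l3⟩ := step 2
  obtain ⟨n3, l4⟩ := step 3
  obtain ⟨n4, l5⟩ := step 4
  obtain ⟨n5, l6⟩ := step 5
  obtain ⟨n6, l7⟩ := step 6
  obtain ⟨n7, l8⟩ := step 7
  obtain ⟨n8, -⟩ := step 8
  have l2 : p ^ 2 ≤ 1 / 5 * p := by nlinarith
  norm_num only at l3 l4 l5 l6 l7 l8
  have h0 : |28 - 11 * p + 3 * p ^ 2| ≤ 28 - 11 * p + 3 * p ^ 2 := by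
    rw [abs_of_nonneg]; linarith
  have h2 : |-21 * p + 95 * p ^ 2 + 53 * p ^ 3 - 7 * p ^ 4| ≤ 21 * p - 94 * p ^ 2 := by
    rw [abs_le]; constructor <;> linarith
  have h3 : |63 * p ^ 2 - 84 * p ^ 3 - 36 * p ^ 4 - 3 * p ^ 5| ≤ 63 * p ^ 2 - 84 * p ^ 3 := by
    rw [abs_le]; constructor <;> linarith
  have h4 : |-105 * p ^ 3 + 28 * p ^ 4 + 21 * p ^ 5|
      ≤ 105 * p ^ 3 - 28 * p ^ 4 - 21 * p ^ 5 := by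
    rw [abs_le]; constructor <;> linarith
  have h5 : |105 * p ^ 4 + 14 * p ^ 5 - 7 * p ^ 6| ≤ 105 * p ^ 4 + 14 * p ^ 5 := by
    rw [abs_le]; constructor <;> linarith
  have h6 : |-63 * p ^ 5 - 18 * p ^ 6 + p ^ 7| ≤ 63 * p ^ 5 + 18 * p ^ 6 := by
    rw [abs_le]; constructor <;> linarith
  have h7 : |21 * p ^ 6 + 7 * p ^ 7| ≤ 21 * p ^ 6 + 7 * p ^ 7 := by
    rw [abs_le]; constructor <;> linarith
  have h8 : |-3 * p ^ 7 - p ^ 8| ≤ 3 * p ^ 7 + p ^ 8 := by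
    rw [abs_le]; constructor <;> linarith
  have tangent : 0 ≤ (p - 1 / 5) ^ 2 := sq_nonneg _
  rcases abs_cases (3 - 69 * p - 21 * p ^ 2 + 7 * p ^ 3) with ⟨h1, -⟩ | ⟨h1, -⟩ <;> linarith

theorem norm_reducedNumerator_le {p : ℝ} {u : ℂ} (hp0 : 0 ≤ p) (hp : p ≤ 1 / 5)
    (hu : ‖u‖ ≤ 1) :
    ‖reducedNumerator p u‖ ≤ (1 - p) * (p ^ 7 + 10 * p ^ 6 + 36 * p ^ 5 + 65 * p ^ 4
      + 121 * p ^ 3 + 134 * p ^ 2 + 70 * p + 31) := by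
  have term (c : ℝ) (n : ℕ) : ‖(c : ℂ) * u ^ n‖ ≤ |c| := by
    rw [norm_mul, norm_pow, Complex.norm_real, Real.norm_eq_abs]
    exact mul_le_of_le_one_right (abs_nonneg c) (pow_le_one₀ (norm_nonneg u) hu)
  refine le_trans ?_ (sum_abs_coeff_le hp0 hp)
  have expand : reducedNumerator p u =
      ((28 - 11 * p + 3 * p ^ 2 : ℝ) : ℂ) * u ^ 0
      + ((3 - 69 * p - 21 * p ^ 2 + 7 * p ^ 3 : ℝ) : ℂ) * u ^ 1
      + ((-21 * p + 95 * p ^ 2 + 53 * p ^ 3 - 7 * p ^ 4 : ℝ) : ℂ) * u ^ 2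
      + ((63 * p ^ 2 - 84 * p ^ 3 - 36 * p ^ 4 - 3 * p ^ 5 : ℝ) : ℂ) * u ^ 3
      + ((-105 * p ^ 3 + 28 * p ^ 4 + 21 * p ^ 5 : ℝ) : ℂ) * u ^ 4
      + ((105 * p ^ 4 + 14 * p ^ 5 - 7 * p ^ 6 : ℝ) : ℂ) * u ^ 5
      + ((-63 * p ^ 5 - 18 * p ^ 6 + p ^ 7 : ℝ) : ℂ) * u ^ 6
      + ((21 * p ^ 6 + 7 * p ^ 7 : ℝ) : ℂ) * u ^ 7
      + ((-3 * p ^ 7 - p ^ 8 : ℝ) : ℂ) * u ^ 8 := by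
    push_cast [reducedNumerator]
    ring
  rw [expand]
  iterate 8 refine norm_add_le_of_le ?_ (term _ _)
  exact term _ _

theorem difference_div_eq {a b w D M N : ℂ} (ha : a ≠ 0) (hb : b ≠ 0) (hw : w ≠ 0)
    (hD : D ≠ 0) :
    1 / (2 * w) * (a⁻¹ ^ 3 * (M / D - 1) - b⁻¹ ^ 3 * (N / D - 1)) =
      (b ^ 3 * (M - D) - a ^ 3 * (N - D)) / (2 * w) / ((a * b) ^ 3 * D) := by
  field_simp

theorem one_sub_le_norm_one_sub {v : ℂ} {p : ℝ} (hv : ‖v‖ ≤ p) : 1 - p ≤ ‖1 - v‖ := by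
  have := norm_sub_norm_le (1 : ℂ) v
  rw [norm_one] at this
  linarith

/-- For every `z ∈ ℂ` with `0 < |z| ≤ q^{−1/2}`,
`|(1/(2z²))·[(1 − q^{−1/2})^{−3}(g₁(z) − 1) − (1 + q^{−1/2})^{−3}(g₋₁(z) − 1)]|
  ≤ (q^{−7} + 10 q^{−6} + 36 q^{−5} + 65 q^{−4} + 121 q^{−3} + 134 q^{−2} + 70 q^{−1} + 31)
      /((1 − q^{−1})^{10} · q^{1/2})`. -/
theorem stmt_5 (q : ℝ) (hq : 5 ≤ q) (z : ℂ) (hz0 : 0 < ‖z‖) (hz : ‖z‖ ≤ q ^ (-(1 : ℝ) / 2)) :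
    ‖(1 / (2 * z ^ 2)) *
        ((((1 - q ^ (-(1 : ℝ) / 2) : ℝ) : ℂ))⁻¹ ^ 3 * (gEps q 1 z - 1)
          - (((1 + q ^ (-(1 : ℝ) / 2) : ℝ) : ℂ))⁻¹ ^ 3 * (gEps q (-1) z - 1))‖ ≤
      (q⁻¹ ^ 7 + 10 * q⁻¹ ^ 6 + 36 * q⁻¹ ^ 5 + 65 * q⁻¹ ^ 4 + 121 * q⁻¹ ^ 3
          + 134 * q⁻¹ ^ 2 + 70 * q⁻¹ + 31) / ((1 - q⁻¹) ^ 10 * q ^ ((1 : ℝ) / 2)) := by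
  have hq0 : 0 < q := by linarith
  set s : ℝ := q ^ (-(1 : ℝ) / 2) with hs
  have hs0 : 0 < s := Real.rpow_pos_of_pos hq0 _
  have hs2 : s ^ 2 = q⁻¹ := by
    rw [hs, ← Real.rpow_natCast, ← Real.rpow_mul hq0.le, ← Real.rpow_neg_one]
    norm_num
  have hs3 : q ^ (-(3 : ℝ) / 2) = s ^ 3 := by
    rw [hs, ← Real.rpow_natCast, ← Real.rpow_mul hq0.le]
    norm_num
  have hs1 : q ^ ((1 : ℝ) / 2) = s⁻¹ := by
    rw [hs, ← Real.rpow_neg hq0.le]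
    norm_num
  have hqs : q = (s ^ 2)⁻¹ := by rw [hs2, inv_inv]
  have hp : s ^ 2 ≤ 1 / 5 := by
    rw [hs2, ← one_div]
    exact one_div_le_one_div_of_le (by norm_num) hq
  have hs_lt : s < 1 := by nlinarith
  have hsC : (s : ℂ) ≠ 0 := by exact_mod_cast hs0.ne'
  have hzC : z ≠ 0 := norm_pos_iff.mp hz0
  have hw : ‖z ^ 2‖ ≤ s ^ 2 := by
    rw [norm_pow]
    exact pow_le_pow_left₀ hz0.le hz 2
  obtain ⟨u, hu⟩ : ∃ u : ℂ, z ^ 2 = (s : ℂ) ^ 2 * u :=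
    ⟨z ^ 2 / (s : ℂ) ^ 2, by field_simp⟩
  have hu1 : ‖u‖ ≤ 1 := by
    rw [hu, norm_mul, norm_pow, Complex.norm_real, Real.norm_of_nonneg hs0.le] at hw
    exact le_of_mul_le_mul_left (by simpa using hw) (by positivity : (0 : ℝ) < s ^ 2)
  have hqz : (q : ℂ) * z ^ 4 = (s : ℂ) ^ 2 * u ^ 2 := by
    rw [show z ^ 4 = (z ^ 2) ^ 2 by ring, hu, hqs]
    push_cast
    field_simp
  have hqz_norm : ‖(q : ℂ) * z ^ 4‖ ≤ s ^ 2 := by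
    rw [hqz, norm_mul, norm_pow, norm_pow, Complex.norm_real, Real.norm_of_nonneg hs0.le]
    exact mul_le_of_le_one_right (by positivity) (pow_le_one₀ (norm_nonneg u) hu1)
  have hp1 : 0 < 1 - s ^ 2 := by linarith
  have hD1 := one_sub_le_norm_one_sub hw
  have hD2 := one_sub_le_norm_one_sub hqz_norm
  have hD_norm : (1 - s ^ 2) ^ 8 ≤ ‖(1 - z ^ 2) ^ 7 * (1 - (q : ℂ) * z ^ 4)‖ := by
    rw [norm_mul, norm_pow, pow_succ]
    gcongr
  have hD : (1 - z ^ 2) ^ 7 * (1 - (q : ℂ) * z ^ 4) ≠ 0 :=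
    norm_pos_iff.mp (lt_of_lt_of_le (by positivity) hD_norm)
  have ha : ((1 - s : ℝ) : ℂ) ≠ 0 := by exact_mod_cast (sub_pos.mpr hs_lt).ne'
  have hb : ((1 + s : ℝ) : ℂ) ≠ 0 := by exact_mod_cast (by positivity : (1 + s) ≠ 0)
  have hab : ((1 - s : ℝ) : ℂ) * ((1 + s : ℝ) : ℂ) = ((1 - s ^ 2 : ℝ) : ℂ) := by
    push_cast
    ring
  have hnum : (((1 + s : ℝ) : ℂ) ^ 3 * (Neps q 1 z - (1 - z ^ 2) ^ 7 * (1 - (q : ℂ) * z ^ 4))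
      - ((1 - s : ℝ) : ℂ) ^ 3 * (Neps q (-1) z - (1 - z ^ 2) ^ 7 * (1 - (q : ℂ) * z ^ 4)))
      / (2 * z ^ 2) = s * reducedNumerator ((s ^ 2 : ℝ) : ℂ) u := by
    rw [div_eq_iff (by simpa using hzC), hqz]
    simp only [Neps, hs3, ← hs, ← hs2]
    rw [show z ^ 4 = (z ^ 2) ^ 2 by ring, show z ^ 6 = (z ^ 2) ^ 3 by ring,
      show z ^ 8 = (z ^ 2) ^ 4 by ring, hu]
    push_cast [reducedNumerator]
    ring
  rw [gEps, gEps, difference_div_eq ha hb (pow_ne_zero 2 hzC) hD, hnum, hab, norm_div, norm_mul,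
    norm_mul, norm_pow, Complex.norm_real, Complex.norm_real, Real.norm_of_nonneg hs0.le,
    Real.norm_of_nonneg hp1.le, ← hs2, hs1]
  have hF := norm_reducedNumerator_le (sq_nonneg s) hp hu1
  set B : ℝ := (s ^ 2) ^ 7 + 10 * (s ^ 2) ^ 6 + 36 * (s ^ 2) ^ 5 + 65 * (s ^ 2) ^ 4
    + 121 * (s ^ 2) ^ 3 + 134 * (s ^ 2) ^ 2 + 70 * s ^ 2 + 31 with hB
  have hB0 : 0 ≤ B := by positivity
  calc _ ≤ s * ((1 - s ^ 2) * B) / ((1 - s ^ 2) ^ 3 * (1 - s ^ 2) ^ 8) := by gcongr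
    _ = B / ((1 - s ^ 2) ^ 10 * s⁻¹) := by
      have := hp1.ne'
      field_simp
end

section
/- For every z ∈ ℂ with |z| ≤ q^{−1/2}, one has |g_odd(z)| ≤ ((1 + 7 q^{−1} + 7 q^{−2} + q^{−3})/(1 − q^{−1})⁸) · |z|, and in particular |g_odd(z)| ≤ 17 |z| (since the displayed constant is less than 17 for q ≥ 5). -/
theorem rpow_neg_half_sq {q : ℝ} (hq : 0 ≤ q) : (q ^ (-(1 : ℝ) / 2)) ^ 2 = q⁻¹ := by
  rw [← Real.rpow_natCast, ← Real.rpow_mul hq, ← Real.rpow_neg_one]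
  norm_num

/-- Bound for `gOdd` in terms of an upper bound `t` for `‖z‖ ^ 2` and `q * ‖z‖ ^ 4`. -/
theorem norm_gOdd_le {q t : ℝ} {z : ℂ} (hq : 0 ≤ q) (ht : t < 1) (hz : ‖z‖ ^ 2 ≤ t)
    (hqz : q * ‖z‖ ^ 4 ≤ t) :
    ‖gOdd q z‖ ≤ (1 + 7 * t + 7 * t ^ 2 + t ^ 3) / (1 - t) ^ 8 * ‖z‖ := by
  have hnum : ‖1 + 7 * z ^ 2 + 7 * z ^ 4 + z ^ 6‖ ≤ 1 + 7 * t + 7 * t ^ 2 + t ^ 3 :=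
    calc ‖1 + 7 * z ^ 2 + 7 * z ^ 4 + z ^ 6‖
        ≤ ‖(1 : ℂ)‖ + ‖7 * z ^ 2‖ + ‖7 * z ^ 4‖ + ‖z ^ 6‖ := norm_add₄_le
      _ = 1 + 7 * ‖z‖ ^ 2 + 7 * (‖z‖ ^ 2) ^ 2 + (‖z‖ ^ 2) ^ 3 := by simp; ring
      _ ≤ 1 + 7 * t + 7 * t ^ 2 + t ^ 3 := by gcongr
  have hsq : 1 - t ≤ ‖1 - z ^ 2‖ := by
    have h := norm_sub_norm_le 1 (z ^ 2)
    rw [norm_one, norm_pow] at h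
    linarith
  have hquart : 1 - t ≤ ‖1 - (q : ℂ) * z ^ 4‖ := by
    have h := norm_sub_norm_le 1 ((q : ℂ) * z ^ 4)
    rw [norm_one, norm_mul, norm_pow, Complex.norm_of_nonneg hq] at h
    linarith
  have hpos : 0 < 1 - t := sub_pos.2 ht
  have hden : (1 - t) ^ 8 ≤ ‖1 - z ^ 2‖ ^ 7 * ‖1 - (q : ℂ) * z ^ 4‖ := by
    rw [pow_succ]
    gcongr
  rw [gOdd, norm_div, norm_mul, norm_mul, norm_pow, mul_div_assoc, mul_comm]
  gcongr
  exact (norm_nonneg _).trans hnum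

/-- The constant in the bound for `gOdd` is at most `17` for `q ≥ 5`. -/
theorem gOdd_const_le {t : ℝ} (h0 : 0 ≤ t) (ht : t ≤ 1 / 5) :
    (1 + 7 * t + 7 * t ^ 2 + t ^ 3) / (1 - t) ^ 8 ≤ 17 := by
  calc (1 + 7 * t + 7 * t ^ 2 + t ^ 3) / (1 - t) ^ 8
      ≤ (1 + 7 * (1 / 5) + 7 * (1 / 5) ^ 2 + (1 / 5) ^ 3) / (1 - 1 / 5) ^ 8 := by
        gcongr
    _ ≤ 17 := by norm_num

/-- For every `z ∈ ℂ` with `|z| ≤ q^{−1/2}`,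
`|g_odd(z)| ≤ ((1 + 7 q^{−1} + 7 q^{−2} + q^{−3})/(1 − q^{−1})⁸) · |z|`,
and in particular `|g_odd(z)| ≤ 17 |z|`. -/
theorem stmt_6 (q : ℝ) (hq : 5 ≤ q) (z : ℂ) (hz : ‖z‖ ≤ q ^ (-(1 : ℝ) / 2)) :
    ‖gOdd q z‖ ≤ ((1 + 7 * q⁻¹ + 7 * q⁻¹ ^ 2 + q⁻¹ ^ 3) / (1 - q⁻¹) ^ 8) * ‖z‖ ∧
      ‖gOdd q z‖ ≤ 17 * ‖z‖ := by
  have hq0 : 0 < q := by linarith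
  have ht : q⁻¹ ≤ 1 / 5 := by
    rw [one_div]
    gcongr
  have hz2 : ‖z‖ ^ 2 ≤ q⁻¹ := by
    rw [← rpow_neg_half_sq hq0.le]
    gcongr
  have hqz : q * ‖z‖ ^ 4 ≤ q⁻¹ :=
    calc q * ‖z‖ ^ 4 = q * (‖z‖ ^ 2) ^ 2 := by ring
      _ ≤ q * q⁻¹ ^ 2 := by gcongr
      _ = q⁻¹ := by field_simp
  have h := norm_gOdd_le hq0.le (by linarith) hz2 hqz
  refine ⟨h, h.trans ?_⟩
  gcongr
  exact gOdd_const_le (inv_nonneg.2 hq0.le) ht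
end

section
/- For every z ∈ ℂ with |z| ≤ q^{−1/2}, one has |(1/2)(Φ₁(z) − Φ₋₁(z))| < 58 · q^{−1/2}, where Φ₁ = Φ_{ε=1} and Φ₋₁ = Φ_{ε=−1}. (This is the estimate for f_even^−(q^{−1/2}, q^{−1/2}, q^{−1/2}, z; q), the odd part in the first three variables of the even part of the D₄ rational function.) -/
/-- The numerator of the odd part of `Φ`, divided by `q^{−1/2}`, as a polynomial in `w = z²` with
`b = q⁻¹`. -/
def oddPartNumerator (b w : ℂ) : ℂ :=
  (3 + b) + (7 - 18 * b + 3 * b ^ 2) * w - 7 * (1 - b ^ 2) * w ^ 2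
    + (-3 + 18 * b - 7 * b ^ 2) * w ^ 3 - (b + 3 * b ^ 2) * w ^ 4

lemma norm_oddPartNumerator_lt {b : ℝ} (hb0 : 0 ≤ b) (hb : b ≤ 1 / 5) {w : ℂ} (hw : ‖w‖ ≤ b) :
    ‖oddPartNumerator b w‖ < 49 / 10 := by
  have hterm (c C : ℝ) (n : ℕ) (hc : |c| ≤ C) : ‖(c : ℂ) * w ^ n‖ ≤ C * b ^ n := by
    rw [norm_mul, norm_pow, Complex.norm_real, Real.norm_eq_abs]
    gcongr
    exact (abs_nonneg c).trans hc
  have h0 := hterm (3 + b) (16 / 5) 0 (by rw [abs_le]; constructor <;> linarith)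
  have h1 := hterm (7 - 18 * b + 3 * b ^ 2) (7 - 18 * b + 3 * b ^ 2) 1
    (abs_of_nonneg (by nlinarith)).le
  have h2 := hterm (7 * (1 - b ^ 2)) 7 2 (by rw [abs_le]; constructor <;> nlinarith)
  have h3 := hterm (-3 + 18 * b - 7 * b ^ 2) 3 3 (by rw [abs_le]; constructor <;> nlinarith)
  have h4 := hterm (b + 3 * b ^ 2) 1 4 (by rw [abs_le]; constructor <;> nlinarith)
  have hsplit : oddPartNumerator b w = ((3 + b : ℝ) : ℂ) * w ^ 0
      + ((7 - 18 * b + 3 * b ^ 2 : ℝ) : ℂ) * w ^ 1 - ((7 * (1 - b ^ 2) : ℝ) : ℂ) * w ^ 2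
      + ((-3 + 18 * b - 7 * b ^ 2 : ℝ) : ℂ) * w ^ 3 - ((b + 3 * b ^ 2 : ℝ) : ℂ) * w ^ 4 := by
    rw [oddPartNumerator]
    push_cast
    ring
  have hb2 : b ^ 2 ≤ (1 / 5) ^ 2 := by gcongr
  have hb3 : b ^ 3 ≤ (1 / 5) ^ 3 := by gcongr
  have hb4 : b ^ 4 ≤ (1 / 5) ^ 4 := by gcongr
  have hlin : (7 - 18 * b + 3 * b ^ 2) * b ^ 1 ≤ 1 := by nlinarith [sq_nonneg (b - 1 / 5)]
  rw [hsplit]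
  refine (norm_sub_le_of_le (norm_add_le_of_le (norm_sub_le_of_le
    (norm_add_le_of_le h0 h1) h2) h3) h4).trans_lt ?_
  norm_num at *
  linarith

lemma half_sub_PhiEps_eq {q a : ℝ} (ha : 0 < a) (ha1 : a < 1) (hq : q = (a ^ 2)⁻¹) (z : ℂ) :
    (1 / 2 : ℂ) * (PhiEps q 1 z - PhiEps q (-1) z) =
      a * oddPartNumerator ((a ^ 2 : ℝ) : ℂ) (z ^ 2) /
        (((1 - a ^ 2 : ℝ) : ℂ) ^ 3 * ((1 - z ^ 2) ^ 7 * (1 - (q : ℂ) * z ^ 4))) := by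
  have hhalf : q ^ (-(1 : ℝ) / 2) = a := by
    rw [hq, ← Real.rpow_natCast, ← Real.rpow_neg ha.le, ← Real.rpow_mul ha.le]
    norm_num
  have hthree : q ^ (-(3 : ℝ) / 2) = a ^ 3 := by
    rw [hq, ← Real.rpow_natCast, ← Real.rpow_neg ha.le, ← Real.rpow_mul ha.le,
      ← Real.rpow_natCast]
    norm_num
  have hinv : q⁻¹ = a ^ 2 := by rw [hq, inv_inv]
  have hm : (1 - a : ℂ) ≠ 0 := by exact_mod_cast (sub_pos.2 ha1).ne'
  have hp : (1 + a : ℂ) ≠ 0 := by exact_mod_cast (by positivity : 1 + a ≠ 0)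
  have hfac : ((1 - a ^ 2 : ℝ) : ℂ) = (1 - a) * (1 + a) := by push_cast; ring
  simp only [PhiEps, gEps, Neps, hhalf, hthree, hinv, hfac, oddPartNumerator]
  generalize (1 - z ^ 2) ^ 7 * (1 - (q : ℂ) * z ^ 4) = D
  push_cast
  rw [show (1 - -1 * a : ℂ) = 1 + a by ring, one_mul]
  simp only [div_eq_mul_inv, mul_inv]
  generalize D⁻¹ = E
  field_simp
  ring

lemma le_norm_denominator {q b : ℝ} (hb0 : 0 < b) (hb1 : b ≤ 1) (hq : q = b⁻¹) {z : ℂ}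
    (hz : ‖z ^ 2‖ ≤ b) :
    (1 - b) ^ 11 ≤
      ‖((1 - b : ℝ) : ℂ) ^ 3 * ((1 - z ^ 2) ^ 7 * (1 - (q : ℂ) * z ^ 4))‖ := by
  have hsub (u : ℂ) (hu : ‖u‖ ≤ b) : 1 - b ≤ ‖1 - u‖ := by
    have := norm_sub_norm_le (1 : ℂ) u
    rw [norm_one] at this
    linarith
  have hfour : ‖(q : ℂ) * z ^ 4‖ ≤ b := by
    rw [show z ^ 4 = (z ^ 2) ^ 2 by ring, norm_mul, norm_pow, Complex.norm_real, hq,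
      Real.norm_of_nonneg (inv_nonneg.2 hb0.le)]
    calc b⁻¹ * ‖z ^ 2‖ ^ 2 ≤ b⁻¹ * b ^ 2 := by gcongr
      _ = b := by field_simp
  have hnonneg : 0 ≤ 1 - b := sub_nonneg.2 hb1
  rw [norm_mul, norm_mul, norm_pow, norm_pow, Complex.norm_real, Real.norm_of_nonneg hnonneg]
  calc (1 - b) ^ 11 = (1 - b) ^ 3 * ((1 - b) ^ 7 * (1 - b)) := by ring
    _ ≤ (1 - b) ^ 3 * (‖1 - z ^ 2‖ ^ 7 * ‖1 - (q : ℂ) * z ^ 4‖) := by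
      gcongr
      · exact hsub _ hz
      · exact hsub _ hfour

/-- For every `z ∈ ℂ` with `|z| ≤ q^{−1/2}`, `|(1/2)(Φ₁(z) − Φ₋₁(z))| < 58 · q^{−1/2}`. -/
theorem stmt_7 (q : ℝ) (hq : 5 ≤ q) (z : ℂ) (hz : ‖z‖ ≤ q ^ (-(1 : ℝ) / 2)) :
    ‖(1 / 2 : ℂ) * (PhiEps q 1 z - PhiEps q (-1) z)‖ < 58 * q ^ (-(1 : ℝ) / 2) := by
  have hq0 : 0 < q := by linarith
  set a := q ^ (-(1 : ℝ) / 2) with ha_def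
  have ha : 0 < a := Real.rpow_pos_of_pos hq0 _
  have hsq : a ^ 2 = q⁻¹ := by
    rw [ha_def, ← Real.rpow_natCast, ← Real.rpow_mul hq0.le, ← Real.rpow_neg_one]
    norm_num
  have hqa : q = (a ^ 2)⁻¹ := by rw [hsq, inv_inv]
  have hb : a ^ 2 ≤ 1 / 5 := by
    rw [hsq, ← one_div]
    gcongr
  have hw : ‖z ^ 2‖ ≤ a ^ 2 := by
    rw [norm_pow]
    gcongr
  have hden : (4 / 5 : ℝ) ^ 11 ≤ ‖((1 - a ^ 2 : ℝ) : ℂ) ^ 3 *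
      ((1 - z ^ 2) ^ 7 * (1 - (q : ℂ) * z ^ 4))‖ :=
    le_trans (by gcongr; linarith)
      (le_norm_denominator (by positivity) (by linarith) hqa hw)
  have hnum := norm_oddPartNumerator_lt (sq_nonneg a) hb hw
  rw [half_sub_PhiEps_eq ha (by nlinarith) hqa z, norm_div, norm_mul, Complex.norm_real,
    Real.norm_of_nonneg ha.le, div_lt_iff₀ (lt_of_lt_of_le (by norm_num) hden), mul_comm 58 a,
    mul_assoc]
  gcongr
  linarith
end

section
/- Assume in addition that q is a prime power (natural number) with q ≡ 1 (mod 4), so q = 5 or q ≥ 9. Then for every z ∈ ℂ with |z| ≤ q^{−1/2}, one has |(1/2)(Φ₁(z) + Φ₋₁(z))| > 1/20, where Φ₁ = Φ_{ε=1} and Φ₋₁ = Φ_{ε=−1}. Equivalently, 1/|f_even^+(q^{−1/2}, q^{−1/2}, q^{−1/2}, z; q)| < 20. -/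
/-- The numerator of `(Φ₁ + Φ₋₁)/2` over `(1 - s)³ (1 - w)⁷ (1 - w²/s)`, where `s = q⁻¹` and
`w = z²`. -/
noncomputable def evenNumerator (s : ℝ) (w : ℂ) : ℂ :=
  ((1 + 3 * s : ℝ) : ℂ) + ((7 - 15 * s + s ^ 2 - s ^ 3 : ℝ) : ℂ) * w
    + ((7 * (1 - 5 * s + 5 * s ^ 2 - s ^ 3) : ℝ) : ℂ) * w ^ 2
    + ((1 - s + 15 * s ^ 2 - 7 * s ^ 3 : ℝ) : ℂ) * w ^ 3
    - ((3 * s ^ 2 + s ^ 3 : ℝ) : ℂ) * w ^ 4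

lemma norm_ofReal_mul_pow_le {a b s : ℝ} {w : ℂ} (ha : 0 ≤ a) (hab : a ≤ b) (hw : ‖w‖ ≤ s)
    (n : ℕ) : ‖(a : ℂ) * w ^ n‖ ≤ b * s ^ n := by
  rw [norm_mul, norm_pow, Complex.norm_of_nonneg ha]
  gcongr
  exact ha.trans hab

lemma one_fifth_le_norm_evenNumerator {s : ℝ} (hs : 0 < s) (hs5 : s ≤ 1 / 5) {w : ℂ}
    (hw : ‖w‖ ≤ s) : 1 / 5 ≤ ‖evenNumerator s w‖ := by
  have hs2 : s ^ 2 ≤ s / 5 := by nlinarith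
  have hs2' : 0 < s ^ 2 := by positivity
  have hs3 : s ^ 3 ≤ s ^ 2 / 5 := by nlinarith
  have hs3' : 0 < s ^ 3 := by positivity
  have hs4 : s ^ 4 ≤ s ^ 3 / 5 := by nlinarith
  have h0 : ‖((1 + 3 * s : ℝ) : ℂ)‖ = 1 + 3 * s := Complex.norm_of_nonneg (by positivity)
  have h1 := norm_ofReal_mul_pow_le (a := 7 - 15 * s + s ^ 2 - s ^ 3) (b := 7 - 14 * s)
    (by linarith) (by linarith) hw 1
  have h2 := norm_ofReal_mul_pow_le (a := 7 * (1 - 5 * s + 5 * s ^ 2 - s ^ 3)) (b := 7)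
    (by nlinarith) (by linarith) hw 2
  have h3 := norm_ofReal_mul_pow_le (a := 1 - s + 15 * s ^ 2 - 7 * s ^ 3) (b := 2)
    (by linarith) (by linarith) hw 3
  have h4 := norm_ofReal_mul_pow_le (a := 3 * s ^ 2 + s ^ 3) (b := 1)
    (by positivity) (by linarith) hw 4
  rw [pow_one, pow_one] at h1
  have t4 := norm_sub_norm_le (evenNumerator s w + ((3 * s ^ 2 + s ^ 3 : ℝ) : ℂ) * w ^ 4)
    (((3 * s ^ 2 + s ^ 3 : ℝ) : ℂ) * w ^ 4)
  rw [add_sub_cancel_right, evenNumerator, sub_add_cancel] at t4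
  have t3 := norm_sub_le_norm_add (((1 + 3 * s : ℝ) : ℂ)
    + ((7 - 15 * s + s ^ 2 - s ^ 3 : ℝ) : ℂ) * w
    + ((7 * (1 - 5 * s + 5 * s ^ 2 - s ^ 3) : ℝ) : ℂ) * w ^ 2)
    (((1 - s + 15 * s ^ 2 - 7 * s ^ 3 : ℝ) : ℂ) * w ^ 3)
  have t2 := norm_sub_le_norm_add (((1 + 3 * s : ℝ) : ℂ)
    + ((7 - 15 * s + s ^ 2 - s ^ 3 : ℝ) : ℂ) * w)
    (((7 * (1 - 5 * s + 5 * s ^ 2 - s ^ 3) : ℝ) : ℂ) * w ^ 2)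
  have t1 := norm_sub_le_norm_add (((1 + 3 * s : ℝ) : ℂ))
    (((7 - 15 * s + s ^ 2 - s ^ 3 : ℝ) : ℂ) * w)
  rw [evenNumerator]
  linarith

lemma norm_one_sub_le_one_add {w : ℂ} {s : ℝ} (hw : ‖w‖ ≤ s) : ‖1 - w‖ ≤ 1 + s := by
  have h := norm_sub_le 1 w
  rw [norm_one] at h
  linarith

lemma one_sub_ne_zero_of_norm_lt_one {w : ℂ} (hw : ‖w‖ < 1) : 1 - w ≠ 0 := by
  intro h
  rw [← sub_eq_zero.mp h, norm_one] at hw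
  exact lt_irrefl _ hw

lemma half_PhiEps_add_PhiEps {q : ℝ} (hq : 1 < q) {z : ℂ} (hz : 1 - z ^ 2 ≠ 0)
    (hqz : 1 - (q : ℂ) * z ^ 4 ≠ 0) :
    (1 / 2 : ℂ) * (PhiEps q 1 z + PhiEps q (-1) z) =
      evenNumerator q⁻¹ (z ^ 2) /
        (((1 - q⁻¹ : ℝ) : ℂ) ^ 3 * ((1 - z ^ 2) ^ 7 * (1 - (q : ℂ) * z ^ 4))) := by
  have hq0 : 0 < q := by linarith
  set u : ℝ := q ^ (-(1 : ℝ) / 2) with hu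
  have hu2 : q⁻¹ = u ^ 2 := by
    rw [hu, ← Real.rpow_natCast, ← Real.rpow_mul hq0.le, ← Real.rpow_neg_one]
    norm_num
  have hu3 : q ^ (-(3 : ℝ) / 2) = u ^ 3 := by
    rw [hu, ← Real.rpow_natCast, ← Real.rpow_mul hq0.le]
    norm_num
  have hlt : u ^ 2 < 1 := hu2 ▸ inv_lt_one_of_one_lt₀ hq
  have hm : (1 : ℂ) - u ≠ 0 := by
    norm_cast
    nlinarith
  have hp : (1 : ℂ) + u ≠ 0 := by
    norm_cast
    nlinarith
  have hs : (1 : ℂ) - (u : ℂ) ^ 2 = (1 - u) * (1 + u) := by ring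
  simp only [PhiEps, gEps, Neps, evenNumerator, ← hu, hu3, hu2]
  generalize 1 - (q : ℂ) * z ^ 4 = d at hqz ⊢
  generalize 1 - z ^ 2 = c at hz ⊢
  push_cast
  simp only [neg_mul, one_mul, sub_neg_eq_add, hs]
  field_simp
  ring

/-- If `q` is a prime power with `q ≡ 1 (mod 4)` (so `q = 5` or `q ≥ 9`), then for every
`z ∈ ℂ` with `|z| ≤ q^{−1/2}` one has `|(1/2)(Φ₁(z) + Φ₋₁(z))| > 1/20`. -/
theorem stmt_8 (q : ℕ) (hq : IsPrimePow q) (h4 : q % 4 = 1) (h5 : 5 ≤ q)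
    (z : ℂ) (hz : ‖z‖ ≤ (q : ℝ) ^ (-(1 : ℝ) / 2)) :
    1 / 20 < ‖(1 / 2 : ℂ) * (PhiEps (q : ℝ) 1 z + PhiEps (q : ℝ) (-1) z)‖ := by
  have hq5 : (5 : ℝ) ≤ q := by exact_mod_cast h5
  have hq0 : (0 : ℝ) < q := by linarith
  have hs : (0 : ℝ) < (q : ℝ)⁻¹ := inv_pos.mpr hq0
  have hs5 : (q : ℝ)⁻¹ ≤ 1 / 5 := by
    rw [one_div]
    exact inv_anti₀ (by norm_num) hq5
  have hw : ‖z ^ 2‖ ≤ (q : ℝ)⁻¹ := by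
    calc ‖z ^ 2‖ ≤ ((q : ℝ) ^ (-(1 : ℝ) / 2)) ^ 2 := by rw [norm_pow]; gcongr
      _ = (q : ℝ)⁻¹ := by
        rw [← Real.rpow_natCast, ← Real.rpow_mul hq0.le, ← Real.rpow_neg_one]
        norm_num
  have hqw : ‖((q : ℝ) : ℂ) * z ^ 4‖ ≤ (q : ℝ)⁻¹ := by
    calc ‖((q : ℝ) : ℂ) * z ^ 4‖ = q * ‖z ^ 2‖ ^ 2 := by
          rw [norm_mul, Complex.norm_of_nonneg hq0.le, ← norm_pow, ← pow_mul]
      _ ≤ q * (q : ℝ)⁻¹ ^ 2 := by gcongr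
      _ = (q : ℝ)⁻¹ := by field_simp
  have hz0 := one_sub_ne_zero_of_norm_lt_one (hw.trans_lt (by linarith))
  have hqz0 := one_sub_ne_zero_of_norm_lt_one (hqw.trans_lt (by linarith))
  rw [half_PhiEps_add_PhiEps (by linarith) hz0 hqz0]
  have hP := one_fifth_le_norm_evenNumerator hs hs5 hw
  have hA := norm_one_sub_le_one_add hw
  have hB := norm_one_sub_le_one_add hqw
  generalize (q : ℝ)⁻¹ = s at *
  have hD : ‖((1 - s : ℝ) : ℂ) ^ 3 * ((1 - z ^ 2) ^ 7 * (1 - ((q : ℝ) : ℂ) * z ^ 4))‖ < 4 := by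
    rw [norm_mul, norm_mul, norm_pow, norm_pow, Complex.norm_of_nonneg (by linarith)]
    calc (1 - s) ^ 3 * (‖1 - z ^ 2‖ ^ 7 * ‖1 - ((q : ℝ) : ℂ) * z ^ 4‖)
        ≤ (1 - s) ^ 3 * ((1 + s) ^ 7 * (1 + s)) := by
          have : 0 ≤ 1 - s := by linarith
          gcongr
      _ = (1 - s ^ 2) ^ 3 * (1 + s) ^ 5 := by ring
      _ ≤ 1 ^ 3 * (1 + 1 / 5) ^ 5 := by
          have : 0 ≤ 1 - s ^ 2 := by nlinarith
          gcongr
          nlinarith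
      _ < 4 := by norm_num
  have hD0 : 0 < ‖((1 - s : ℝ) : ℂ) ^ 3 * ((1 - z ^ 2) ^ 7 * (1 - ((q : ℝ) : ℂ) * z ^ 4))‖ := by
    rw [norm_pos_iff]
    have : ((1 - s : ℝ) : ℂ) ≠ 0 := by
      rw [Complex.ofReal_ne_zero]
      linarith
    positivity
  rw [norm_div, lt_div_iff₀ hD0]
  linarith
end

section
/- The function g_odd is holomorphic on the open disk {z ∈ ℂ : |z| < q^{−1/4}}; writing g_odd(z) = Σ_{l ≥ 0} c_l z^l for its Taylor expansion at 0, for every real η > 0 and every odd integer l ≥ 1 one has |c_l| < (843/(1 − 5^{−4η})) · q^{(l−1)(1/4 + η)}. (The coefficients c_l for odd l are the values P_l(q^{−1/2}, q^{−1/2}, q^{−1/2}; q) of the odd-indexed coefficient polynomials of the D₄ rational function.) -/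
/-- The coefficients of `(1 + 7w + 7w² + w³)/(1 − w)⁷`. -/
def regularCoeff (n : ℕ) : ℕ :=
  (n + 6).choose 6 + 7 * (n + 5).choose 6 + 7 * (n + 4).choose 6 + (n + 3).choose 6

/-- The coefficients of `1/(1 − q w²)`. -/
noncomputable def poleCoeff (q : ℝ) (n : ℕ) : ℝ :=
  if Even n then √q ^ n else 0

/-- The coefficients of `(1 + 7w + 7w² + w³)/((1 − w)⁷(1 − q w²))`. -/
noncomputable def productCoeff (q : ℝ) (n : ℕ) : ℝ :=
  ∑ p ∈ Finset.HasAntidiagonal.antidiagonal n, poleCoeff q p.1 * regularCoeff p.2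

lemma HasSum.of_eq {ι M : Type*} [AddCommMonoid M] [TopologicalSpace M] {f g : ι → M} {a b : M}
    (h : HasSum f a) (hfg : ∀ i, g i = f i) (hab : b = a) : HasSum g b := by
  rwa [funext hfg, hab]

lemma hasSum_shifted_choose_six {𝕜 : Type*} [RCLike 𝕜] {w : 𝕜} (hw : ‖w‖ < 1) {m k : ℕ}
    (hmk : k + m = 6) :
    HasSum (fun n : ℕ => ((n + k).choose 6 : 𝕜) * w ^ n) (w ^ m * (1 / (1 - w) ^ 7)) := by
  have h := (hasSum_choose_mul_geometric_of_norm_lt_one 6 hw).mul_left (w ^ m)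
  rw [← hasSum_nat_add_iff' m, Finset.sum_eq_zero, sub_zero]
  · refine h.of_eq (fun n => ?_) rfl
    rw [show n + m + k = n + 6 by omega]
    ring
  · intro i hi
    have hi := Finset.mem_range.1 hi
    rw [Nat.choose_eq_zero_of_lt (by omega)]
    simp

lemma hasSum_regularCoeff {𝕜 : Type*} [RCLike 𝕜] {w : 𝕜} (hw : ‖w‖ < 1) :
    HasSum (fun n : ℕ => (regularCoeff n : 𝕜) * w ^ n)
      ((1 + 7 * w + 7 * w ^ 2 + w ^ 3) / (1 - w) ^ 7) := by
  have h := (((hasSum_shifted_choose_six hw (m := 0) (k := 6) rfl).add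
    ((hasSum_shifted_choose_six hw (m := 1) (k := 5) rfl).mul_left 7)).add
    ((hasSum_shifted_choose_six hw (m := 2) (k := 4) rfl).mul_left 7)).add
    (hasSum_shifted_choose_six hw (m := 3) (k := 3) rfl)
  refine h.of_eq (fun n => ?_) ?_
  · simp only [regularCoeff]
    push_cast
    ring
  · ring

lemma hasSum_poleCoeff {q : ℝ} (hq : 0 ≤ q) {w : ℂ} (hw : ‖(q : ℂ) * w ^ 2‖ < 1) :
    HasSum (fun n : ℕ => (poleCoeff q n : ℂ) * w ^ n) (1 - (q : ℂ) * w ^ 2)⁻¹ := by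
  have hinj : Function.Injective (fun n : ℕ => 2 * n) := fun a b h => by simpa using h
  rw [← hinj.hasSum_iff]
  · refine (hasSum_geometric_of_norm_lt_one hw).of_eq (fun n => ?_) rfl
    simp only [Function.comp_apply, poleCoeff, even_two_mul, if_true, pow_mul, Real.sq_sqrt hq]
    push_cast
    rw [mul_pow]
  · intro n hn
    have : ¬ Even n := fun ⟨m, hm⟩ => hn ⟨m, by simp only; omega⟩
    simp [poleCoeff, this]

lemma hasSum_productCoeff {q : ℝ} (hq : 0 ≤ q) {w : ℂ} (hw : ‖w‖ < 1)
    (hqw : ‖(q : ℂ) * w ^ 2‖ < 1) :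
    HasSum (fun n : ℕ => (productCoeff q n : ℂ) * w ^ n)
      ((1 + 7 * w + 7 * w ^ 2 + w ^ 3) / ((1 - w) ^ 7 * (1 - (q : ℂ) * w ^ 2))) := by
  have hp := hasSum_poleCoeff hq hqw
  have hr := hasSum_regularCoeff hw
  have hpn := hp.summable.norm
  have hrn := hr.summable.norm
  have h := (summable_norm_sum_mul_antidiagonal_of_summable_norm hpn hrn).of_norm.hasSum
  rw [← tsum_mul_tsum_eq_tsum_sum_antidiagonal_of_summable_norm hpn hrn, hp.tsum_eq,
    hr.tsum_eq] at h
  refine h.of_eq (fun n => ?_) ?_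
  · simp only [productCoeff]
    push_cast
    rw [Finset.sum_mul]
    refine Finset.sum_congr rfl fun p hp => ?_
    rw [← Finset.HasAntidiagonal.mem_antidiagonal.1 hp, pow_add]
    ring
  · rw [div_eq_mul_inv, div_eq_mul_inv, mul_inv]
    ring

lemma poleCoeff_nonneg (q : ℝ) (n : ℕ) : 0 ≤ poleCoeff q n := by
  unfold poleCoeff
  split_ifs <;> positivity

lemma poleCoeff_le (q : ℝ) (n : ℕ) : poleCoeff q n ≤ √q ^ n := by
  unfold poleCoeff
  split_ifs
  · rfl
  · positivity

lemma productCoeff_nonneg (q : ℝ) (n : ℕ) : 0 ≤ productCoeff q n :=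
  Finset.sum_nonneg fun p _ => mul_nonneg (poleCoeff_nonneg q p.1) (Nat.cast_nonneg _)

lemma productCoeff_le {q : ℝ} (hq : 1 < q) (n : ℕ) :
    productCoeff q n ≤ √q ^ n *
      ((1 + 7 * (√q)⁻¹ + 7 * (√q)⁻¹ ^ 2 + (√q)⁻¹ ^ 3) / (1 - (√q)⁻¹) ^ 7) := by
  have hs : 1 < √q := by rwa [Real.lt_sqrt zero_le_one, one_pow]
  have hs0 : 0 < √q := by positivity
  have h := hasSum_regularCoeff (w := (√q)⁻¹)
    (by rw [Real.norm_of_nonneg (by positivity)]; exact inv_lt_one_of_one_lt₀ hs)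
  calc productCoeff q n
      ≤ ∑ p ∈ Finset.HasAntidiagonal.antidiagonal n,
          √q ^ n * (regularCoeff p.2 * (√q)⁻¹ ^ p.2) := by
        refine Finset.sum_le_sum fun p hp => ?_
        rw [← Finset.HasAntidiagonal.mem_antidiagonal.1 hp]
        calc poleCoeff q p.1 * regularCoeff p.2 ≤ √q ^ p.1 * regularCoeff p.2 := by
              gcongr; exact poleCoeff_le q p.1
          _ = _ := by rw [pow_add, inv_pow]; field_simp
    _ = √q ^ n * ∑ j ∈ Finset.range (n + 1), (regularCoeff j : ℝ) * (√q)⁻¹ ^ j := by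
        rw [← Finset.mul_sum, Finset.Nat.sum_antidiagonal_eq_sum_range_succ_mk,
          ← Finset.sum_range_reflect]
        refine congrArg _ (Finset.sum_congr rfl fun j hj => ?_)
        have := Finset.mem_range.1 hj
        simp only [show n - (n + 1 - 1 - j) = j by omega]
    _ ≤ _ := by
        gcongr
        exact sum_le_hasSum _ (fun j _ => by positivity) h

lemma regular_value_lt {s : ℝ} (hs0 : 0 ≤ s) (hs : s ≤ 9 / 20) :
    (1 + 7 * s + 7 * s ^ 2 + s ^ 3) / (1 - s) ^ 7 < 843 := by
  have h1 : (11 / 20 : ℝ) ^ 7 ≤ (1 - s) ^ 7 :=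
    pow_le_pow_left₀ (by norm_num) (by linarith) 7
  have h2 : s ^ 2 ≤ (9 / 20) ^ 2 := pow_le_pow_left₀ hs0 hs 2
  have h3 : s ^ 3 ≤ (9 / 20) ^ 3 := pow_le_pow_left₀ hs0 hs 3
  norm_num at h1 h2 h3
  rw [div_lt_iff₀ (by linarith)]
  linarith

lemma inv_sqrt_le_of_five_le {q : ℝ} (hq : 5 ≤ q) : (√q)⁻¹ ≤ 9 / 20 := by
  have : 20 / 9 ≤ √q := Real.le_sqrt_of_sq_le (by norm_num; linarith)
  calc (√q)⁻¹ ≤ (20 / 9 : ℝ)⁻¹ := by gcongr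
    _ = 9 / 20 := by norm_num

lemma norm_mul_pow_four_lt_one {q : ℝ} (hq : 0 < q) {z : ℂ} (hz : ‖z‖ < q ^ (-(1 : ℝ) / 4)) :
    ‖(q : ℂ) * z ^ 4‖ < 1 := by
  have h : ‖z‖ ^ 4 < q⁻¹ := by
    calc ‖z‖ ^ 4 < (q ^ (-(1 : ℝ) / 4)) ^ 4 := by gcongr
      _ = q⁻¹ := by
        rw [← Real.rpow_natCast, ← Real.rpow_mul hq.le, ← Real.rpow_neg_one]
        norm_num
  rw [norm_mul, norm_pow, Complex.norm_real, Real.norm_of_nonneg hq.le]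
  calc q * ‖z‖ ^ 4 < q * q⁻¹ := by gcongr
    _ = 1 := mul_inv_cancel₀ hq.ne'

lemma norm_sq_lt_one {q : ℝ} (hq : 1 < q) {z : ℂ} (hz : ‖z‖ < q ^ (-(1 : ℝ) / 4)) :
    ‖z ^ 2‖ < 1 := by
  have h : ‖z‖ < 1 := hz.trans (Real.rpow_lt_one_of_one_lt_of_neg hq (by norm_num))
  rw [norm_pow]
  exact pow_lt_one₀ (norm_nonneg _) h two_ne_zero

lemma differentiableOn_gOdd {q : ℝ} (hq : 1 < q) :
    DifferentiableOn ℂ (gOdd q) {z : ℂ | ‖z‖ < q ^ (-(1 : ℝ) / 4)} := by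
  unfold gOdd
  refine DifferentiableOn.div (by fun_prop) (by fun_prop) fun z hz => ?_
  exact mul_ne_zero (pow_ne_zero 7 (one_sub_ne_zero_of_norm_lt_one (norm_sq_lt_one hq hz)))
    (one_sub_ne_zero_of_norm_lt_one (norm_mul_pow_four_lt_one (by linarith) hz))

/-- The Taylor coefficients of `gOdd q` at `0`. -/
noncomputable def gOddCoeff (q : ℝ) (l : ℕ) : ℂ :=
  if Odd l then productCoeff q (l / 2) else 0

lemma hasSum_gOddCoeff {q : ℝ} (hq : 1 < q) {z : ℂ} (hz : ‖z‖ < q ^ (-(1 : ℝ) / 4)) :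
    HasSum (fun l : ℕ => gOddCoeff q l * z ^ l) (gOdd q z) := by
  have hinj : Function.Injective (fun n : ℕ => 2 * n + 1) := fun a b h => by simpa using h
  rw [← hinj.hasSum_iff]
  · have hpole := norm_mul_pow_four_lt_one (by linarith) hz
    rw [show z ^ 4 = (z ^ 2) ^ 2 by ring] at hpole
    refine ((hasSum_productCoeff (by linarith) (norm_sq_lt_one hq hz) hpole).mul_left z).of_eq
      (fun n => ?_) ?_
    · have hn : (2 * n + 1) / 2 = n := by omega
      simp only [Function.comp_apply, gOddCoeff, odd_two_mul_add_one, if_true, hn]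
      ring
    · simp only [gOdd]
      ring
  · intro l hl
    have : ¬ Odd l := fun ⟨m, hm⟩ => hl ⟨m, hm.symm⟩
    simp [gOddCoeff, this]

lemma norm_gOddCoeff_lt {q : ℝ} (hq : 5 ≤ q) (k : ℕ) :
    ‖gOddCoeff q (2 * k + 1)‖ < 843 * √q ^ k := by
  have hk : (2 * k + 1) / 2 = k := by omega
  have hs : 0 < √q := Real.sqrt_pos.2 (by linarith)
  rw [gOddCoeff, if_pos (odd_two_mul_add_one k), hk, Complex.norm_real,
    Real.norm_of_nonneg (productCoeff_nonneg q k)]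
  refine (productCoeff_le (by linarith) k).trans_lt ?_
  rw [mul_comm]
  gcongr
  exact regular_value_lt (by positivity) (inv_sqrt_le_of_five_le hq)

/-- `g_odd` is holomorphic on the open disk `|z| < q^{−1/4}`; writing
`g_odd(z) = Σ_{l ≥ 0} c_l z^l` for its Taylor expansion at `0`, for every `η > 0` and every odd
`l ≥ 1`, `|c_l| < (843/(1 − 5^{−4η})) · q^{(l−1)(1/4 + η)}`. -/
theorem stmt_10 (q : ℝ) (hq : 5 ≤ q) :
    DifferentiableOn ℂ (gOdd q) {z : ℂ | ‖z‖ < q ^ (-(1 : ℝ) / 4)} ∧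
    ∃ c : ℕ → ℂ,
      (∀ z : ℂ, ‖z‖ < q ^ (-(1 : ℝ) / 4) → HasSum (fun l : ℕ => c l * z ^ l) (gOdd q z)) ∧
      ∀ η : ℝ, 0 < η → ∀ l : ℕ, Odd l → 1 ≤ l →
        ‖c l‖ < (843 / (1 - (5 : ℝ) ^ (-(4 * η)))) * q ^ (((l : ℝ) - 1) * (1 / 4 + η)) := by
  refine ⟨differentiableOn_gOdd (by linarith), gOddCoeff q,
    fun z hz => hasSum_gOddCoeff (by linarith) hz, fun η hη l hl _ => ?_⟩
  obtain ⟨k, rfl⟩ := hl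
  have ht0 : (0 : ℝ) < 5 ^ (-(4 * η)) := by positivity
  have ht1 : (5 : ℝ) ^ (-(4 * η)) < 1 :=
    Real.rpow_lt_one_of_one_lt_of_neg (by norm_num) (by linarith)
  have hconst : (843 : ℝ) ≤ 843 / (1 - 5 ^ (-(4 * η))) := by
    rw [le_div_iff₀ (by linarith)]
    linarith
  have hpow : √q ^ k ≤ q ^ ((((2 * k + 1 : ℕ) : ℝ) - 1) * (1 / 4 + η)) := by
    rw [Real.sqrt_eq_rpow, ← Real.rpow_natCast, ← Real.rpow_mul (by linarith)]
    refine Real.rpow_le_rpow_of_exponent_le (by linarith) ?_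
    have : 0 ≤ (k : ℝ) * η := by positivity
    push_cast
    linarith
  calc ‖gOddCoeff q (2 * k + 1)‖ < 843 * √q ^ k := norm_gOddCoeff_lt hq k
    _ ≤ _ := mul_le_mul hconst hpow (by positivity) (by linarith)
end

section
/- For each ε ∈ {1, −1}, the function g_ε is holomorphic on the open disk {z ∈ ℂ : |z| < q^{−1/4}}; writing g_ε(z) = Σ_{l ≥ 0} c_l z^l for its Taylor expansion at 0, for every real η > 0 and every even integer l ≥ 2 one has |c_l| < (843/(1 − 5^{−4η})) · q^{l(1/4 + η)}. (The coefficients c_l for even l are the values P_l(ε q^{−1/2}, ε q^{−1/2}, ε q^{−1/2}; q) of the even-indexed coefficient polynomials of the D₄ rational function.) -/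
open Finset

/-- The coefficient sequence of the polynomial `1 + a X + b X² + c X³ + d X⁴`. -/
def quarticCoeff {R : Type*} [Semiring R] (a b c d : R) : ℕ → R
  | 0 => 1
  | 1 => a
  | 2 => b
  | 3 => c
  | 4 => d
  | _ => 0

theorem hasSum_quarticCoeff {𝕜 : Type*} [RCLike 𝕜] (a b c d w : 𝕜) :
    HasSum (fun n => quarticCoeff a b c d n * w ^ n)
      (1 + a * w + b * w ^ 2 + c * w ^ 3 + d * w ^ 4) := by
  have h := hasSum_sum_of_ne_finset_zero (s := range 5) (L := SummationFilter.unconditional ℕ)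
    (f := fun n => quarticCoeff a b c d n * w ^ n) (by
      intro n hn
      obtain ⟨k, rfl⟩ := Nat.exists_eq_add_of_le (not_lt.mp (mt mem_range.mpr hn))
      rw [add_comm 5 k]
      simp [quarticCoeff])
  simpa [sum_range_succ, quarticCoeff] using h

theorem norm_quarticCoeff_le {a b c d : ℂ} {a' b' c' d' : ℝ} (ha : ‖a‖ ≤ a') (hb : ‖b‖ ≤ b')
    (hc : ‖c‖ ≤ c') (hd : ‖d‖ ≤ d') (n : ℕ) :
    ‖quarticCoeff a b c d n‖ ≤ quarticCoeff a' b' c' d' n := by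
  match n with
  | 0 => simp [quarticCoeff]
  | 1 => exact ha
  | 2 => exact hb
  | 3 => exact hc
  | 4 => exact hd
  | _ + 5 => simp [quarticCoeff]

/-- Coefficients of the product of two power series. -/
def cauchyProd {R : Type*} [Semiring R] (a b : ℕ → R) (n : ℕ) : R :=
  ∑ x ∈ antidiagonal n, a x.1 * b x.2

theorem HasSum.cauchyProd {𝕜 : Type*} [RCLike 𝕜] {a b : ℕ → 𝕜} {w A B : 𝕜}
    (ha : HasSum (fun n => a n * w ^ n) A) (hb : HasSum (fun n => b n * w ^ n) B) :
    HasSum (fun n => cauchyProd a b n * w ^ n) (A * B) := by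
  have hterm : (fun n => _root_.cauchyProd a b n * w ^ n) = fun n =>
      ∑ x ∈ antidiagonal n, a x.1 * w ^ x.1 * (b x.2 * w ^ x.2) := by
    funext n
    rw [_root_.cauchyProd, sum_mul]
    refine sum_congr rfl fun x hx => ?_
    rw [← mem_antidiagonal.mp hx, pow_add]
    ring
  have hsa := ha.summable.norm
  have hsb := hb.summable.norm
  rw [hterm, ← ha.tsum_eq, ← hb.tsum_eq,
    tsum_mul_tsum_eq_tsum_sum_antidiagonal_of_summable_norm hsa hsb]
  exact (summable_norm_sum_mul_antidiagonal_of_summable_norm hsa hsb).of_norm.hasSum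

theorem norm_cauchyProd_le {a b : ℕ → ℂ} {a' b' : ℕ → ℝ} (ha : ∀ n, ‖a n‖ ≤ a' n)
    (hb : ∀ n, ‖b n‖ ≤ b' n) (n : ℕ) : ‖cauchyProd a b n‖ ≤ cauchyProd a' b' n := by
  refine (norm_sum_le _ _).trans (sum_le_sum fun x _ => ?_)
  rw [norm_mul]
  exact mul_le_mul (ha _) (hb _) (norm_nonneg _) ((norm_nonneg _).trans (ha _))

/-- The coefficients of `f(X²)`, where `a` are the coefficients of `f`. -/
def evenExtend {R : Type*} [Semiring R] (a : ℕ → R) (n : ℕ) : R :=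
  if Even n then a (n / 2) else 0

theorem evenExtend_two_mul {R : Type*} [Semiring R] (a : ℕ → R) (n : ℕ) :
    evenExtend a (2 * n) = a n := by
  simp [evenExtend]

theorem HasSum.evenExtend {a : ℕ → ℂ} {w A : ℂ} (ha : HasSum (fun n => a n * (w ^ 2) ^ n) A) :
    HasSum (fun n => evenExtend a n * w ^ n) A := by
  have hinj : Function.Injective fun n : ℕ => 2 * n := mul_right_injective₀ two_ne_zero
  refine (hinj.hasSum_iff fun n hn => ?_).mp ?_
  · have hodd : ¬ Even n := fun ⟨k, hk⟩ => hn ⟨k, by simp only; omega⟩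
    simp [_root_.evenExtend, hodd]
  · simpa [Function.comp_def, evenExtend_two_mul, pow_mul] using ha

theorem cauchyProd_le_of_hasSum {a : ℕ → ℝ} {r y S : ℝ} (ha : ∀ n, 0 ≤ a n) (hr : 0 < r)
    (hy : r⁻¹ ≤ y) (hS : HasSum (fun n => a n * y ^ n) S) (n : ℕ) :
    cauchyProd a (fun k => r ^ k) n ≤ r ^ n * S := by
  have hy0 : 0 ≤ y := (inv_nonneg.mpr hr.le).trans hy
  have hle : cauchyProd a (fun k => r ^ k) n ≤
      ∑ x ∈ antidiagonal n, r ^ n * (a x.1 * y ^ x.1) := by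
    refine sum_le_sum fun x hx => ?_
    have hpow : r ^ x.2 = r ^ n * r⁻¹ ^ x.1 := by
      rw [← mem_antidiagonal.mp hx, pow_add, inv_pow]
      field_simp
    have : r⁻¹ ^ x.1 ≤ y ^ x.1 := pow_le_pow_left₀ (inv_nonneg.mpr hr.le) hy _
    calc a x.1 * r ^ x.2 = r ^ n * (a x.1 * r⁻¹ ^ x.1) := by rw [hpow]; ring
      _ ≤ _ := by gcongr; exact ha _
  refine hle.trans ?_
  rw [← mul_sum, Nat.sum_antidiagonal_eq_sum_range_succ_mk]
  exact mul_le_mul_of_nonneg_left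
    (sum_le_hasSum _ (fun i _ => mul_nonneg (ha i) (pow_nonneg hy0 i)) hS) (pow_nonneg hr.le n)

theorem hasSum_choose_six {𝕜 : Type*} [RCLike 𝕜] {w : 𝕜} (hw : ‖w‖ < 1) :
    HasSum (fun n : ℕ => ((n + 6).choose 6 : 𝕜) * w ^ n) (1 / (1 - w) ^ 7) :=
  hasSum_choose_mul_geometric_of_norm_lt_one 6 hw

theorem hasSum_evenExtend_geometric {q w : ℂ} (hw : ‖q * w ^ 2‖ < 1) :
    HasSum (fun n => evenExtend (fun k => q ^ k) n * w ^ n) (1 - q * w ^ 2)⁻¹ := by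
  refine HasSum.evenExtend ?_
  simpa [mul_pow] using hasSum_geometric_of_norm_lt_one hw

theorem norm_evenExtend_pow_le {q : ℂ} {r : ℝ} (hr : 0 ≤ r) (hq : ‖q‖ = r ^ 2) (n : ℕ) :
    ‖evenExtend (fun k => q ^ k) n‖ ≤ r ^ n := by
  unfold evenExtend
  split_ifs with h
  · obtain ⟨k, rfl⟩ := h
    rw [norm_pow, hq, ← pow_mul]
    exact le_of_eq (by congr 1; omega)
  · simpa using pow_nonneg hr n

theorem mul_pow_four_lt_one {q x : ℝ} (hq : 0 < q) (hx : 0 ≤ x)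
    (hxq : x < q ^ (-(1 : ℝ) / 4)) : q * x ^ 4 < 1 := by
  have h : x ^ 4 < (q ^ (-(1 : ℝ) / 4)) ^ 4 := pow_lt_pow_left₀ hxq hx (by norm_num)
  rw [← Real.rpow_mul_natCast hq.le] at h
  norm_num at h
  rw [Real.rpow_neg_one] at h
  calc q * x ^ 4 < q * q⁻¹ := by gcongr
    _ = 1 := mul_inv_cancel₀ hq.ne'

theorem rpow_neg_half_eq {q : ℝ} (hq : 0 ≤ q) : q ^ (-(1 : ℝ) / 2) = (√q)⁻¹ := by
  rw [neg_div, Real.rpow_neg hq, Real.sqrt_eq_rpow]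

theorem rpow_neg_three_half_eq {q : ℝ} (hq : 0 ≤ q) : q ^ (-(3 : ℝ) / 2) = (√q)⁻¹ ^ 3 := by
  rw [← rpow_neg_half_eq hq, ← Real.rpow_mul_natCast hq]
  norm_num

/-- The coefficients of `gEps q ε`, as a power series in `z²`. -/
noncomputable def gEpsCoeff (q ε : ℝ) : ℕ → ℂ :=
  cauchyProd
    (cauchyProd
      (quarticCoeff
        ((7 - 14 * ε * q ^ (-(1 : ℝ) / 2) + 6 * q⁻¹ - ε * q ^ (-(3 : ℝ) / 2) : ℝ) : ℂ)
        (7 * ((1 - 4 * ε * q ^ (-(1 : ℝ) / 2) + 4 * q⁻¹ - ε * q ^ (-(3 : ℝ) / 2) : ℝ) : ℂ))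
        ((1 - 6 * ε * q ^ (-(1 : ℝ) / 2) + 14 * q⁻¹ - 7 * ε * q ^ (-(3 : ℝ) / 2) : ℝ) : ℂ)
        (-((ε * q ^ (-(3 : ℝ) / 2) : ℝ) : ℂ)))
      (fun n => ((n + 6).choose 6 : ℂ)))
    (evenExtend fun k => (q : ℂ) ^ k)

theorem hasSum_gEps (q ε : ℝ) {z : ℂ} (hz : ‖z‖ < 1) (hqz : ‖(q : ℂ) * z ^ 4‖ < 1) :
    HasSum (fun l => evenExtend (gEpsCoeff q ε) l * z ^ l) (gEps q ε z) := by
  refine HasSum.evenExtend ?_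
  have hz2 : ‖z ^ 2‖ < 1 := by
    rw [norm_pow]; exact pow_lt_one₀ (norm_nonneg _) hz two_ne_zero
  have hqz2 : ‖(q : ℂ) * (z ^ 2) ^ 2‖ < 1 := by rwa [← pow_mul]
  unfold gEpsCoeff
  convert! ((hasSum_quarticCoeff _ _ _ _ (z ^ 2)).cauchyProd (hasSum_choose_six hz2)).cauchyProd
    (hasSum_evenExtend_geometric hqz2) using 1
  rw [gEps, Neps, div_eq_mul_inv, mul_inv, one_div, mul_assoc]
  ring

theorem differentiableOn_gEps (q ε : ℝ) {s : Set ℂ} (hs : ∀ z ∈ s, ‖z‖ < 1)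
    (hqs : ∀ z ∈ s, ‖(q : ℂ) * z ^ 4‖ < 1) : DifferentiableOn ℂ (gEps q ε) s := by
  have hne : ∀ w : ℂ, ‖w‖ < 1 → 1 - w ≠ 0 := fun w hw h => by
    rw [← sub_eq_zero.mp h, norm_one] at hw
    exact lt_irrefl _ hw
  unfold gEps Neps
  refine DifferentiableOn.div (by fun_prop) (by fun_prop) fun z hz => ?_
  refine mul_ne_zero (pow_ne_zero _ (hne _ ?_)) (hne _ (hqs z hz))
  rw [norm_pow]
  exact pow_lt_one₀ (norm_nonneg _) (hs z hz) two_ne_zero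

theorem norm_gEpsCoeff_le {q ε : ℝ} (hq : 5 ≤ q) (hε : |ε| = 1) (n : ℕ) :
    ‖gEpsCoeff q ε n‖ ≤ √q ^ n * 843 := by
  have hq0 : 0 ≤ q := by linarith
  have hr : 0 < √q := Real.sqrt_pos.mpr (by linarith)
  have hinv : q⁻¹ = (√q)⁻¹ ^ 2 := by rw [inv_pow, Real.sq_sqrt hq0]
  set y : ℝ := 4472136 / 10000000 with hy
  have hpy : (√q)⁻¹ ≤ y := by
    rw [inv_le_comm₀ hr (by norm_num [hy])]
    exact Real.le_sqrt_of_sq_le (le_trans (by norm_num [hy]) hq)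
  have hp0 : 0 ≤ (√q)⁻¹ := inv_nonneg.mpr hr.le
  have hp2 : (√q)⁻¹ ^ 2 ≤ y ^ 2 := pow_le_pow_left₀ hp0 hpy 2
  have hp3 : (√q)⁻¹ ^ 3 ≤ y ^ 3 := pow_le_pow_left₀ hp0 hpy 3
  have hp2' : 0 ≤ (√q)⁻¹ ^ 2 := by positivity
  have hp3' : 0 ≤ (√q)⁻¹ ^ 3 := by positivity
  set a' : ℝ := 7 + 14 * y + 6 * y ^ 2 + y ^ 3 with ha'
  set b' : ℝ := 7 * (1 + 4 * y + 4 * y ^ 2 + y ^ 3) with hb'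
  set c' : ℝ := 1 + 6 * y + 14 * y ^ 2 + 7 * y ^ 3 with hc'
  have hnum := norm_cauchyProd_le (b := fun n => ((n + 6).choose 6 : ℂ))
    (b' := fun n => ((n + 6).choose 6 : ℝ))
    (norm_quarticCoeff_le
      (a := ((7 - 14 * ε * q ^ (-(1 : ℝ) / 2) + 6 * q⁻¹ - ε * q ^ (-(3 : ℝ) / 2) : ℝ) : ℂ))
      (b := 7 * ((1 - 4 * ε * q ^ (-(1 : ℝ) / 2) + 4 * q⁻¹ - ε * q ^ (-(3 : ℝ) / 2) : ℝ) : ℂ))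
      (c := ((1 - 6 * ε * q ^ (-(1 : ℝ) / 2) + 14 * q⁻¹ - 7 * ε * q ^ (-(3 : ℝ) / 2) : ℝ) : ℂ))
      (d := -((ε * q ^ (-(3 : ℝ) / 2) : ℝ) : ℂ))
      (a' := a') (b' := b') (c' := c') (d' := y ^ 3) ?_ ?_ ?_ ?_) (fun n => by simp)
  · have hS := (hasSum_quarticCoeff a' b' c' (y ^ 3) y).cauchyProd
      (hasSum_choose_six (w := y) (by norm_num [hy]))
    have hpos := fun n => (norm_nonneg _).trans (hnum n)
    have hq2 : ‖(q : ℂ)‖ = √q ^ 2 := by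
      rw [Real.sq_sqrt hq0, Complex.norm_real, Real.norm_of_nonneg hq0]
    refine (norm_cauchyProd_le hnum (norm_evenExtend_pow_le hr.le hq2) n).trans
      ((cauchyProd_le_of_hasSum hpos hr hpy hS n).trans ?_)
    gcongr
    norm_num [ha', hb', hc', hy]
  all_goals
    simp only [norm_neg, norm_mul, Complex.norm_real, Complex.norm_ofNat, Real.norm_eq_abs,
      rpow_neg_half_eq hq0, rpow_neg_three_half_eq hq0, hinv, hε]
    rcases eq_or_eq_neg_of_abs_eq hε with rfl | rfl
  all_goals
    first
    | rw [abs_of_nonneg hp3']; linarith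
    | rw [abs_le]; constructor <;> linarith
    | refine mul_le_mul_of_nonneg_left (abs_le.mpr ⟨?_, ?_⟩) (by norm_num) <;> linarith

theorem sqrt_pow_mul_lt {q η C : ℝ} (hq : 1 ≤ q) (hη : 0 < η) (hC : 0 < C) (m : ℕ) :
    √q ^ m * C <
      C / (1 - (5 : ℝ) ^ (-(4 * η))) * q ^ (((m + m : ℕ) : ℝ) * (1 / 4 + η)) := by
  have h1 : (5 : ℝ) ^ (-(4 * η)) < 1 :=
    Real.rpow_lt_one_of_one_lt_of_neg (by norm_num) (by linarith)
  have h0 : 0 < (5 : ℝ) ^ (-(4 * η)) := by positivity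
  have hpow : √q ^ m ≤ q ^ (((m + m : ℕ) : ℝ) * (1 / 4 + η)) := by
    rw [Real.sqrt_eq_rpow, ← Real.rpow_mul_natCast (by linarith)]
    refine Real.rpow_le_rpow_of_exponent_le hq ?_
    push_cast
    nlinarith [mul_nonneg (Nat.cast_nonneg (α := ℝ) m) hη.le]
  have hlt : C < C / (1 - (5 : ℝ) ^ (-(4 * η))) := by
    rw [lt_div_iff₀ (by linarith)]
    nlinarith
  have hpos : 0 < √q ^ m := pow_pos (Real.sqrt_pos.mpr (by linarith)) m
  rw [mul_comm]
  exact mul_lt_mul hlt hpow hpos (hC.trans hlt).le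

/-- For each `ε ∈ {1, −1}`, `g_ε` is holomorphic on the open disk `|z| < q^{−1/4}`; writing
`g_ε(z) = Σ_{l ≥ 0} c_l z^l` for its Taylor expansion at `0`, for every `η > 0` and every even
`l ≥ 2`, `|c_l| < (843/(1 − 5^{−4η})) · q^{l(1/4 + η)}`. -/
theorem stmt_11 (q : ℝ) (hq : 5 ≤ q) (ε : ℝ) (hε : ε = 1 ∨ ε = -1) :
    DifferentiableOn ℂ (gEps q ε) {z : ℂ | ‖z‖ < q ^ (-(1 : ℝ) / 4)} ∧
    ∃ c : ℕ → ℂ,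
      (∀ z : ℂ, ‖z‖ < q ^ (-(1 : ℝ) / 4) → HasSum (fun l : ℕ => c l * z ^ l) (gEps q ε z)) ∧
      ∀ η : ℝ, 0 < η → ∀ l : ℕ, Even l → 2 ≤ l →
        ‖c l‖ < (843 / (1 - (5 : ℝ) ^ (-(4 * η)))) * q ^ ((l : ℝ) * (1 / 4 + η)) := by
  have hq0 : 0 < q := by linarith
  have hbd : ∀ z : ℂ, ‖z‖ < q ^ (-(1 : ℝ) / 4) → ‖z‖ < 1 ∧ ‖(q : ℂ) * z ^ 4‖ < 1 := by
    intro z hz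
    refine ⟨hz.trans (Real.rpow_lt_one_of_one_lt_of_neg (by linarith) (by norm_num)), ?_⟩
    rw [norm_mul, norm_pow, Complex.norm_real, Real.norm_of_nonneg hq0.le]
    exact mul_pow_four_lt_one hq0 (norm_nonneg z) hz
  refine ⟨differentiableOn_gEps q ε (fun z hz => (hbd z hz).1) fun z hz => (hbd z hz).2,
    evenExtend (gEpsCoeff q ε), fun z hz => hasSum_gEps q ε (hbd z hz).1 (hbd z hz).2, ?_⟩
  rintro η hη _ ⟨m, rfl⟩ -
  have hε' : |ε| = 1 := by rcases hε with rfl | rfl <;> simp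
  rw [← two_mul, evenExtend_two_mul, two_mul]
  exact (norm_gEpsCoeff_le hq hε' m).trans_lt (sqrt_pow_mul_lt (by linarith) hη (by norm_num) m)
end

section
/- Let c₁, c₂, c₃ ∈ F[x] be monic polynomials such that c = c₁c₂c₃ is squarefree. Let m, b₂, b₃, b₄, b₅ ∈ F[x] be monic divisors of c such that gcd(c₂, b₂) = 1, gcd(b₃, m) = 1, gcd(b₂, b₃) = gcd(b₃, b₄) = gcd(b₄, b₅) = 1, and b₂·m·b₄ is the square of a polynomial. Then deg c₂ + 3·deg b₂ + 2·deg b₃ + deg m + 3·deg b₄ + deg b₅ ≤ 5·deg c₂ + 6·(deg c₁ + deg c₃). Equivalently, |c₂|^{1/2} |b₂|^{3/2} |b₃| |m|^{1/2} |b₄|^{3/2} |b₅|^{1/2} ≤ |c₂|^{5/2} |c/c₂|³. -/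
open UniqueFactorizationMonoid in
lemma IsCoprime.count_normalizedFactors_eq_zero_or {R : Type*} [CommRing R]
    [IsDomain R] [UniqueFactorizationMonoid R] [NormalizationMonoid R] [DecidableEq R] {a b : R}
    (h : IsCoprime a b) (p : R) :
    (normalizedFactors a).count p = 0 ∨ (normalizedFactors b).count p = 0 := by
  by_contra! hp
  have ha := Multiset.count_ne_zero.mp hp.1
  have hb := Multiset.count_ne_zero.mp hp.2
  exact (prime_of_normalized_factor p ha).not_isUnit
    (h.isUnit_of_dvd' (dvd_of_mem_normalizedFactors ha) (dvd_of_mem_normalizedFactors hb))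

/-- Let `c₁, c₂, c₃ ∈ F[x]` be monic with `c = c₁c₂c₃` squarefree, and let
`m, b₂, b₃, b₄, b₅` be monic divisors of `c` with `gcd(c₂,b₂) = gcd(b₃,m) = gcd(b₂,b₃)
= gcd(b₃,b₄) = gcd(b₄,b₅) = 1` and `b₂·m·b₄` a square.  Then
`deg c₂ + 3 deg b₂ + 2 deg b₃ + deg m + 3 deg b₄ + deg b₅ ≤ 5 deg c₂ + 6 (deg c₁ + deg c₃)`. -/
theorem stmt_12 (q : ℕ) (F : Type) [Field F] [Fintype F] (hF : Fintype.card F = q)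
    (c₁ c₂ c₃ m b₂ b₃ b₄ b₅ : Polynomial F)
    (hc₁ : c₁.Monic) (hc₂ : c₂.Monic) (hc₃ : c₃.Monic)
    (hsf : Squarefree (c₁ * c₂ * c₃))
    (hm : m.Monic) (hb₂ : b₂.Monic) (hb₃ : b₃.Monic) (hb₄ : b₄.Monic) (hb₅ : b₅.Monic)
    (hmdvd : m ∣ c₁ * c₂ * c₃) (hb₂dvd : b₂ ∣ c₁ * c₂ * c₃) (hb₃dvd : b₃ ∣ c₁ * c₂ * c₃)
    (hb₄dvd : b₄ ∣ c₁ * c₂ * c₃) (hb₅dvd : b₅ ∣ c₁ * c₂ * c₃)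
    (hcop₁ : IsCoprime c₂ b₂) (hcop₂ : IsCoprime b₃ m)
    (hcop₃ : IsCoprime b₂ b₃) (hcop₄ : IsCoprime b₃ b₄) (hcop₅ : IsCoprime b₄ b₅)
    (hsq : ∃ e : Polynomial F, b₂ * m * b₄ = e ^ 2) :
    c₂.natDegree + 3 * b₂.natDegree + 2 * b₃.natDegree + m.natDegree
        + 3 * b₄.natDegree + b₅.natDegree
      ≤ 5 * c₂.natDegree + 6 * (c₁.natDegree + c₃.natDegree) := by
  classical
  open UniqueFactorizationMonoid in
  have hdvd : c₂ * b₂ ^ 3 * b₃ ^ 2 * m * b₄ ^ 3 * b₅ ∣ c₂ ^ 5 * (c₁ * c₃) ^ 6 := by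
    have h₁ := hc₁.ne_zero
    have h₂ := hc₂.ne_zero
    have h₃ := hc₃.ne_zero
    have hm0 := hm.ne_zero
    have hb20 := hb₂.ne_zero
    have hb30 := hb₃.ne_zero
    have hb40 := hb₄.ne_zero
    have hb50 := hb₅.ne_zero
    have hc0 : c₁ * c₂ * c₃ ≠ 0 := by simp [*]
    rw [dvd_iff_normalizedFactors_le_normalizedFactors (by simp [*]) (by simp [*]),
      Multiset.le_iff_count]
    intro p
    obtain ⟨e, he⟩ := hsq
    have hpar := congrArg (fun f => (normalizedFactors f).count p) he
    have hle : (normalizedFactors (c₁ * c₂ * c₃)).count p ≤ 1 :=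
      Multiset.nodup_iff_count_le_one.mp ((squarefree_iff_nodup_normalizedFactors hc0).mp hsf) p
    have hcount {f : Polynomial F} (hf : f ≠ 0) (hd : f ∣ c₁ * c₂ * c₃) :
        (normalizedFactors f).count p ≤ (normalizedFactors (c₁ * c₂ * c₃)).count p :=
      Multiset.count_le_of_le p ((dvd_iff_normalizedFactors_le_normalizedFactors hf hc0).mp hd)
    have km := hcount hm0 hmdvd
    have k2 := hcount hb20 hb₂dvd
    have k3 := hcount hb30 hb₃dvd
    have k4 := hcount hb40 hb₄dvd
    have k5 := hcount hb50 hb₅dvd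
    have d1 := hcop₁.count_normalizedFactors_eq_zero_or p
    have d2 := hcop₂.count_normalizedFactors_eq_zero_or p
    have d3 := hcop₃.count_normalizedFactors_eq_zero_or p
    have d4 := hcop₄.count_normalizedFactors_eq_zero_or p
    have d5 := hcop₅.count_normalizedFactors_eq_zero_or p
    simp only [normalizedFactors_mul, normalizedFactors_pow, Multiset.count_add,
      Multiset.count_nsmul, ne_eq, mul_eq_zero, pow_eq_zero_iff, not_or, not_false_eq_true,
      and_self, OfNat.ofNat_ne_zero, h₁, h₂, h₃, hm0, hb20, hb30, hb40,
      hb50] at hpar hle km k2 k3 k4 k5 ⊢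
    omega
  have hmonic : (c₂ ^ 5 * (c₁ * c₃) ^ 6).Monic := (hc₂.pow 5).mul ((hc₁.mul hc₃).pow 6)
  have hdeg := Polynomial.natDegree_le_of_dvd hdvd hmonic.ne_zero
  simp only [Polynomial.natDegree_mul, Polynomial.natDegree_pow, ne_eq, mul_eq_zero,
    pow_eq_zero_iff, not_or, not_false_eq_true, and_self, OfNat.ofNat_ne_zero, hc₁.ne_zero,
    hc₂.ne_zero, hc₃.ne_zero, hm.ne_zero, hb₂.ne_zero, hb₃.ne_zero, hb₄.ne_zero,
    hb₅.ne_zero] at hdeg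
  omega
end

section
/- Let m ∈ F[x] be a monic squarefree polynomial and let s ∈ ℂ with Re(s) < 0. Define U_m(s) = ∏_{p | m} q^{(s−1)·deg p} (1 − q^{(1−2s)·deg p})/(1 − q^{−deg p}), the product over the monic irreducible divisors p of m (with U_m(s) = 1 when m is constant). Then |U_m(s)| ≤ 3^{ω(m)} · q^{−Re(s)·deg m}. -/
/-- `U_m(s) = ∏_{p | m} q^{(s−1)·deg p} (1 − q^{(1−2s)·deg p})/(1 − q^{−deg p})`, the product
over the distinct monic irreducible divisors `p` of `m` (equal to `1` when `m` is constant). -/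
noncomputable def Um (q : ℕ) {F : Type} [Field F] (s : ℂ) (m : Polynomial F) : ℂ :=
  haveI := Classical.decEq F
  haveI := Classical.decEq (Polynomial F)
  ∏ p ∈ (UniqueFactorizationMonoid.normalizedFactors m).toFinset,
    (q : ℂ) ^ ((s - 1) * (p.natDegree : ℂ)) *
      (1 - (q : ℂ) ^ ((1 - 2 * s) * (p.natDegree : ℂ))) / (1 - (q : ℂ) ^ (-(p.natDegree : ℂ)))

/-- `ω(m)`: the number of distinct monic irreducible polynomials dividing `m`. -/
noncomputable def omegaPoly {F : Type} [Field F] (m : Polynomial F) : ℕ :=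
  haveI := Classical.decEq F
  haveI := Classical.decEq (Polynomial F)
  (UniqueFactorizationMonoid.normalizedFactors m).toFinset.card

open UniqueFactorizationMonoid in
/-- A monic squarefree polynomial is the product of its distinct monic irreducible factors. -/
theorem Polynomial.Monic.prod_toFinset_normalizedFactors {F : Type} [Field F] [DecidableEq F]
    [DecidableEq (Polynomial F)] {m : Polynomial F} (hm : m.Monic) (hsf : Squarefree m) :
    ∏ p ∈ (normalizedFactors m).toFinset, p = m := by
  have hnd := (squarefree_iff_nodup_normalizedFactors hm.ne_zero).mp hsf
  rw [Finset.prod_eq_multiset_prod, Multiset.toFinset_val, hnd.dedup, Multiset.map_id',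
    prod_normalizedFactors_eq hm.ne_zero, hm.normalize_eq_self]

/-- The bound for a single factor of `U_m(s)`, at a prime of degree `d ≥ 1`. -/
theorem norm_Um_factor_le {q : ℕ} (hq : 3 ≤ q) {s : ℂ} (hs : s.re < 0) {d : ℕ} (hd : 1 ≤ d) :
    ‖(q : ℂ) ^ ((s - 1) * (d : ℂ)) * (1 - (q : ℂ) ^ ((1 - 2 * s) * (d : ℂ))) /
      (1 - (q : ℂ) ^ (-(d : ℂ)))‖ ≤ 3 * (q : ℝ) ^ (-(s.re * (d : ℝ))) := by
  have hq0 : 0 < q := by omega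
  have hqR : (3 : ℝ) ≤ q := by exact_mod_cast hq
  have hq0R : (0 : ℝ) < q := by linarith
  have hdR : (1 : ℝ) ≤ d := by exact_mod_cast hd
  set A := (q : ℝ) ^ (-(s.re * (d : ℝ))) with hA
  have hA0 : 0 < A := Real.rpow_pos_of_pos hq0R _
  have hden : (2 / 3 : ℝ) ≤ ‖1 - (q : ℂ) ^ (-(d : ℂ))‖ := by
    have h1 : ‖(q : ℂ) ^ (-(d : ℂ))‖ ≤ 1 / 3 := by
      rw [Complex.norm_natCast_cpow_of_pos hq0]
      calc (q : ℝ) ^ (-(d : ℂ)).re ≤ (q : ℝ) ^ (-1 : ℝ) :=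
            Real.rpow_le_rpow_of_exponent_le (by linarith) (by simpa using hd)
        _ ≤ 1 / 3 := by
            rw [Real.rpow_neg_one, one_div]
            exact inv_anti₀ (by norm_num) hqR
    have h2 := norm_sub_norm_le (1 : ℂ) ((q : ℂ) ^ (-(d : ℂ)))
    rw [norm_one] at h2
    linarith
  have hre₁ : ((s - 1) * (d : ℂ)).re = (s.re - 1) * d := by simp
  have hre₂ : ((1 - 2 * s) * (d : ℂ)).re = (1 - 2 * s.re) * d := by simp
  have hnum : ‖(q : ℂ) ^ ((s - 1) * (d : ℂ)) * (1 - (q : ℂ) ^ ((1 - 2 * s) * (d : ℂ)))‖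
      ≤ 2 * A := by
    have h2 := norm_sub_le (1 : ℂ) ((q : ℂ) ^ ((1 - 2 * s) * (d : ℂ)))
    rw [norm_mul]
    rw [norm_one, Complex.norm_natCast_cpow_of_pos hq0, hre₂] at h2
    rw [Complex.norm_natCast_cpow_of_pos hq0, hre₁]
    have h3 : (q : ℝ) ^ ((s.re - 1) * d) ≤ A :=
      Real.rpow_le_rpow_of_exponent_le (by linarith) (by nlinarith)
    have h4 : (q : ℝ) ^ ((s.re - 1) * d) * (q : ℝ) ^ ((1 - 2 * s.re) * d) = A := by
      rw [← Real.rpow_add hq0R, hA]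
      congr 1
      ring
    calc _ ≤ (q : ℝ) ^ ((s.re - 1) * d) * (1 + (q : ℝ) ^ ((1 - 2 * s.re) * d)) := by gcongr
      _ ≤ 2 * A := by rw [mul_add, h4]; linarith
  rw [norm_div, div_le_iff₀ (by linarith)]
  nlinarith

/-- For `m ∈ F[x]` monic squarefree and `s ∈ ℂ` with `Re(s) < 0`,
`|U_m(s)| ≤ 3^{ω(m)} · q^{−Re(s)·deg m}`. -/
theorem stmt_13 (q : ℕ) (hq : 3 ≤ q) (F : Type) [Field F] [Fintype F]
    (hF : Fintype.card F = q) (m : Polynomial F) (hm : m.Monic) (hsf : Squarefree m)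
    (s : ℂ) (hs : s.re < 0) :
    ‖Um q s m‖ ≤ (3 : ℝ) ^ (omegaPoly m) * (q : ℝ) ^ (-(s.re * (m.natDegree : ℝ))) := by
  classical
  have hdeg := congrArg Polynomial.natDegree (hm.prod_toFinset_normalizedFactors hsf)
  have hirr : ∀ p ∈ (UniqueFactorizationMonoid.normalizedFactors m).toFinset, Irreducible p :=
    fun p hp ↦ UniqueFactorizationMonoid.irreducible_of_normalized_factor p
      (Multiset.mem_toFinset.mp hp)
  rw [Polynomial.natDegree_prod _ _ fun p hp ↦ (hirr p hp).ne_zero] at hdeg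
  have hq0 : (0 : ℝ) < q := by exact_mod_cast (by omega : 0 < q)
  have hexp : -(s.re * (m.natDegree : ℝ)) =
      ∑ p ∈ (UniqueFactorizationMonoid.normalizedFactors m).toFinset,
        -(s.re * (p.natDegree : ℝ)) := by
    rw [← hdeg, Nat.cast_sum, Finset.mul_sum, Finset.sum_neg_distrib]
  have hbound : ‖∏ p ∈ (UniqueFactorizationMonoid.normalizedFactors m).toFinset,
      (q : ℂ) ^ ((s - 1) * (p.natDegree : ℂ)) *
        (1 - (q : ℂ) ^ ((1 - 2 * s) * (p.natDegree : ℂ))) / (1 - (q : ℂ) ^ (-(p.natDegree : ℂ)))‖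
      ≤ 3 ^ (UniqueFactorizationMonoid.normalizedFactors m).toFinset.card *
        (q : ℝ) ^ (-(s.re * (m.natDegree : ℝ))) := by
    rw [norm_prod, hexp, Real.rpow_sum_of_pos hq0, ← Finset.prod_const, ← Finset.prod_mul_distrib]
    exact Finset.prod_le_prod (fun _ _ ↦ norm_nonneg _) fun p hp ↦
      norm_Um_factor_le hq hs (hirr p hp).natDegree_pos
  unfold Um omegaPoly
  convert hbound
end

section
/- For every real q ≥ 3 and every integer N ≥ 1, Σ_{n=1}^{N} (q^{−n/2} + q^{n/2})/n < log((1 − 3^{−1/2})^{−1}) + 4 (1 − 3^{−1/2})^{−1} · q^{N/2}/N, where log denotes the natural logarithm. -/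
theorem sum_Icc_pow_div_le {s : ℝ} (hs : 27 / 16 ≤ s) {N : ℕ} (hN : 1 ≤ N) :
    ∑ n ∈ Finset.Icc 1 N, s ^ n / (n : ℝ) ≤ 9 * (s ^ N / N) := by
  induction N, hN using Nat.le_induction with
  | base => simp; linarith
  | succ N hN ih =>
    rw [Finset.sum_Icc_succ_top (by omega)]
    rcases hN.eq_or_lt with rfl | h2
    · norm_num
      nlinarith
    · have h2' : (2 : ℝ) ≤ N := by exact_mod_cast h2
      have hstep : 9 * (s ^ N / N) ≤ 8 * (s ^ (N + 1) / ((N + 1 : ℕ) : ℝ)) := by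
        have hp : 0 < s ^ N := by positivity
        push_cast
        rw [pow_succ, ← mul_div_assoc, ← mul_div_assoc, div_le_div_iff₀ (by positivity) (by positivity)]
        have : 9 * ((N : ℝ) + 1) ≤ 8 * s * N := by nlinarith
        nlinarith
      linarith

theorem sum_Icc_pow_div_le_neg_log {x : ℝ} (hx : 0 ≤ x) (hx1 : x < 1) (N : ℕ) :
    ∑ n ∈ Finset.Icc 1 N, x ^ n / (n : ℝ) ≤ -Real.log (1 - x) := by
  have h := Real.hasSum_pow_div_log_of_abs_lt_one (x := x) (by rwa [abs_of_nonneg hx])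
  rw [← Finset.Ico_add_one_right_eq_Icc, Finset.sum_Ico_eq_sum_range]
  refine le_of_eq_of_le (Finset.sum_congr rfl fun n _ => ?_)
    (sum_le_hasSum (Finset.range N) (fun n _ => by positivity) h)
  push_cast
  rw [add_comm 1 n, add_comm 1 (n : ℝ)]

/-- For every real `q ≥ 3` and every integer `N ≥ 1`,
`Σ_{n=1}^{N} (q^{−n/2} + q^{n/2})/n
  < log((1 − 3^{−1/2})⁻¹) + 4 (1 − 3^{−1/2})⁻¹ · q^{N/2}/N`. -/
theorem stmt_14 (q : ℝ) (hq : 3 ≤ q) (N : ℕ) (hN : 1 ≤ N) :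
    ∑ n ∈ Finset.Icc 1 N, (q ^ (-(n : ℝ) / 2) + q ^ ((n : ℝ) / 2)) / (n : ℝ) <
      Real.log ((1 - (3 : ℝ) ^ (-(1 : ℝ) / 2))⁻¹) +
        4 * (1 - (3 : ℝ) ^ (-(1 : ℝ) / 2))⁻¹ * q ^ ((N : ℝ) / 2) / (N : ℝ) := by
  have hpow (n : ℕ) : q ^ ((n : ℝ) / 2) = √q ^ n := by
    rw [Real.sqrt_eq_rpow, ← Real.rpow_natCast, ← Real.rpow_mul (by linarith)]
    congr 1
    ring
  have hinv (n : ℕ) : q ^ (-(n : ℝ) / 2) = (√q ^ n)⁻¹ := by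
    rw [neg_div, Real.rpow_neg (by linarith), hpow]
  have ht : (3 : ℝ) ^ (-(1 : ℝ) / 2) = (√3)⁻¹ := by
    rw [neg_div, Real.rpow_neg (by norm_num), Real.sqrt_eq_rpow]
  have h3 : 27 / 16 ≤ √3 := Real.le_sqrt_of_sq_le (by norm_num)
  have h3q : √3 ≤ √q := Real.sqrt_le_sqrt hq
  have ht1 : (√3)⁻¹ < 1 := inv_lt_one_of_one_lt₀ (by linarith)
  have ht2 : 5 / 9 < (√3)⁻¹ := by
    rw [lt_inv_comm₀ (by norm_num) (by linarith), Real.sqrt_lt' (by norm_num)]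
    norm_num
  have hC : 9 < 4 * (1 - (√3)⁻¹)⁻¹ := by
    rw [← div_eq_mul_inv, lt_div_iff₀ (by linarith)]
    linarith
  simp_rw [hpow, hinv, ht, add_div, Finset.sum_add_distrib]
  rw [Real.log_inv, mul_div_assoc]
  apply add_lt_add_of_le_of_lt
  · refine le_trans (Finset.sum_le_sum fun n _ => ?_)
      (sum_Icc_pow_div_le_neg_log (by positivity) ht1 N)
    rw [← inv_pow]
    gcongr
  · refine (sum_Icc_pow_div_le (h3.trans h3q) hN).trans_lt ?_
    have hq0 : 0 < √q := by linarith
    have hN0 : (0 : ℝ) < N := by exact_mod_cast hN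
    gcongr
end

section
/- For every real q ≥ 9 and every z ∈ ℂ with |z| ≤ q^{−1/2}, |1 + 3q^{−1} + (7 − 15q^{−1} + q^{−2} − q^{−3}) z² + (7 − 35q^{−1} + 35q^{−2} − 7q^{−3}) z⁴ + (1 − q^{−1} + 15q^{−2} − 7q^{−3}) z⁶ − (3q^{−2} + q^{−3}) z⁸| > 2/9. -/
/-- A quartic perturbation bound by the triangle inequality: the coefficients of positive degree
contribute at most their absolute values times powers of `‖w‖`. -/
theorem sub_le_norm_quartic (a b c d e t : ℝ) (w : ℂ) (hw : ‖w‖ ≤ t) :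
    a - |b| * t - |c| * t ^ 2 - |d| * t ^ 3 - |e| * t ^ 4 ≤
      ‖(a : ℂ) + b * w + c * w ^ 2 + d * w ^ 3 - e * w ^ 4‖ := by
  have term (r : ℝ) (n : ℕ) : ‖(r : ℂ) * w ^ n‖ ≤ |r| * t ^ n := by
    rw [norm_mul, norm_pow, Complex.norm_real, Real.norm_eq_abs]
    gcongr
  have ha : a ≤ ‖(a : ℂ)‖ := by
    rw [Complex.norm_real]
    exact le_abs_self a
  have hb := term b 1
  rw [pow_one, pow_one] at hb
  have h₁ := norm_sub_le_norm_add (a : ℂ) (b * w)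
  have h₂ := norm_sub_le_norm_add ((a : ℂ) + b * w) (c * w ^ 2)
  have h₃ := norm_sub_le_norm_add ((a : ℂ) + b * w + c * w ^ 2) (d * w ^ 3)
  have h₄ := norm_sub_norm_le ((a : ℂ) + b * w + c * w ^ 2 + d * w ^ 3) (e * w ^ 4)
  linarith [term c 2, term d 3, term e 4]

/-- For every real `q ≥ 9` and every `z ∈ ℂ` with `|z| ≤ q^{−1/2}`,
`|1 + 3q^{−1} + (7 − 15q^{−1} + q^{−2} − q^{−3}) z² + (7 − 35q^{−1} + 35q^{−2} − 7q^{−3}) z⁴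
  + (1 − q^{−1} + 15q^{−2} − 7q^{−3}) z⁶ − (3q^{−2} + q^{−3}) z⁸| > 2/9`. -/
theorem stmt_17 (q : ℝ) (hq : 9 ≤ q) (z : ℂ) (hz : ‖z‖ ≤ q ^ (-(1 : ℝ) / 2)) :
    2 / 9 <
      ‖((1 + 3 * q⁻¹ : ℝ) : ℂ)
        + ((7 - 15 * q⁻¹ + q⁻¹ ^ 2 - q⁻¹ ^ 3 : ℝ) : ℂ) * z ^ 2
        + ((7 - 35 * q⁻¹ + 35 * q⁻¹ ^ 2 - 7 * q⁻¹ ^ 3 : ℝ) : ℂ) * z ^ 4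
        + ((1 - q⁻¹ + 15 * q⁻¹ ^ 2 - 7 * q⁻¹ ^ 3 : ℝ) : ℂ) * z ^ 6
        - ((3 * q⁻¹ ^ 2 + q⁻¹ ^ 3 : ℝ) : ℂ) * z ^ 8‖ := by
  have hq0 : 0 < q := by linarith
  have hw : ‖z ^ 2‖ ≤ q⁻¹ := by
    calc ‖z ^ 2‖ = ‖z‖ ^ 2 := norm_pow z 2
      _ ≤ (q ^ (-(1 : ℝ) / 2)) ^ 2 := by gcongr
      _ = q⁻¹ := by
        rw [← Real.rpow_natCast, ← Real.rpow_mul hq0.le, ← Real.rpow_neg_one]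
        norm_num
  have ht0 : 0 < q⁻¹ := inv_pos.mpr hq0
  have ht : q⁻¹ ≤ 1 / 9 := by
    rw [one_div]
    exact inv_anti₀ (by norm_num) hq
  have key := sub_le_norm_quartic (1 + 3 * q⁻¹) (7 - 15 * q⁻¹ + q⁻¹ ^ 2 - q⁻¹ ^ 3)
    (7 - 35 * q⁻¹ + 35 * q⁻¹ ^ 2 - 7 * q⁻¹ ^ 3) (1 - q⁻¹ + 15 * q⁻¹ ^ 2 - 7 * q⁻¹ ^ 3)
    (3 * q⁻¹ ^ 2 + q⁻¹ ^ 3) q⁻¹ (z ^ 2) hw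
  simp only [← pow_mul, Nat.reduceMul] at key
  refine lt_of_lt_of_le ?_ key
  generalize q⁻¹ = t at ht0 ht
  have h2 : t ^ 2 ≤ t / 9 := by nlinarith
  have h3 : t ^ 3 ≤ t ^ 2 / 9 := by nlinarith [sq_nonneg t]
  have h4 : t ^ 4 ≤ t ^ 3 / 9 := by nlinarith [pow_pos ht0 3]
  have p2 := pow_pos ht0 2
  have p3 := pow_pos ht0 3
  have p4 := pow_pos ht0 4
  have hb : |7 - 15 * t + t ^ 2 - t ^ 3| ≤ 7 := abs_le.mpr ⟨by linarith, by linarith⟩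
  have hc : |7 - 35 * t + 35 * t ^ 2 - 7 * t ^ 3| ≤ 7 := abs_le.mpr ⟨by linarith, by linarith⟩
  have hd : |1 - t + 15 * t ^ 2 - 7 * t ^ 3| ≤ 2 := abs_le.mpr ⟨by linarith, by linarith⟩
  have he : |3 * t ^ 2 + t ^ 3| ≤ 1 := abs_le.mpr ⟨by linarith, by linarith⟩
  linarith [mul_le_mul_of_nonneg_right hb ht0.le, mul_le_mul_of_nonneg_right hc p2.le,
    mul_le_mul_of_nonneg_right hd p3.le, mul_le_mul_of_nonneg_right he p4.le]
end
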